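/- There exist absolute constants C₀ ≥ 1 and c > 0 with the following property. Let μ be an isotropic log-concave probability measure on ℝⁿ, let C₀·n ≤ m ≤ 2C₀·n, let x₁,…,x_m be independent random vectors each distributed according to μ, and set B_m = absconv{x₁,…,x_m}. Then, with probability greater than 1/2, one has c·√n ≤ d_BM(X_{B_m}, 𝒰_n) ≤ √n, where d_BM(X, 𝒰_n) = inf{ d_BM(X, Y) : Y is an n-dimensional normed space with a 1-unconditional basis }. -/

import Mathlib

open MeasureTheory Set
open scoped ENNReal RealInnerProductSpace Pointwise BigOperators

noncomputable section

abbrev Euc (n : ℕ) := EuclideanSpace ℝ (Fin n)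

/-- The absolute convex hull of a set. -/
def absConv (n : ℕ) (A : Set (Euc n)) : Set (Euc n) := convexHull ℝ (A ∪ -A)

/-- A log-concave function on `ℝⁿ`. -/
def IsLogConcaveFn (n : ℕ) (f : Euc n → ℝ) : Prop :=
  ∀ x y : Euc n, ∀ a b : ℝ, 0 ≤ a → 0 ≤ b → a + b = 1 →
    f x ^ a * f y ^ b ≤ f (a • x + b • y)

/-- `f` is a log-concave density of `μ` with barycenter `0`, total mass `1`
and identity covariance. -/
def IsIsotropicDensity (n : ℕ) (μ : Measure (Euc n)) (f : Euc n → ℝ) : Prop :=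
  (∀ x, 0 ≤ f x) ∧ IsLogConcaveFn n f ∧
  μ = volume.withDensity (fun x => ENNReal.ofReal (f x)) ∧
  IsProbabilityMeasure μ ∧ (∫ x, x ∂μ) = 0 ∧
  ∀ y z : Euc n, (∫ x, ⟪x, y⟫ * ⟪x, z⟫ ∂μ) = ⟪y, z⟫

/-- An isotropic log-concave probability measure on `ℝⁿ`. -/
def IsIsotropicLogConcave (n : ℕ) (μ : Measure (Euc n)) : Prop :=
  ∃ f, IsIsotropicDensity n μ f

/-- A centrally symmetric convex body. -/
def IsSymmConvexBody (n : ℕ) (K : Set (Euc n)) : Prop :=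
  Convex ℝ K ∧ K = -K ∧ IsCompact K ∧ (0 : Euc n) ∈ interior K

/-- A convex body (not necessarily symmetric). -/
def IsConvexBody (n : ℕ) (K : Set (Euc n)) : Prop :=
  Convex ℝ K ∧ IsCompact K ∧ (interior K).Nonempty

/-- The operator norm of `T : X_K → X_L`, where `X_K` and `X_L` carry the gauges of `K`, `L`. -/
def bodyOpNorm (n : ℕ) (K L : Set (Euc n)) (T : Euc n →ₗ[ℝ] Euc n) : ℝ :=
  sSup ((fun x => gauge L (T x)) '' K)

/-- The Banach–Mazur distance between the normed spaces with unit balls `K` and `L`. -/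
def distBM (n : ℕ) (K L : Set (Euc n)) : ℝ :=
  sInf {d : ℝ | ∃ T : Euc n ≃ₗ[ℝ] Euc n,
    d = bodyOpNorm n K L T.toLinearMap * bodyOpNorm n L K T.symm.toLinearMap}

/-- The `ℓ₂ⁿ → ℓ₂ⁿ` operator norm of a linear map. -/
def eucOpNorm (n : ℕ) (T : Euc n →ₗ[ℝ] Euc n) : ℝ :=
  ‖LinearMap.toContinuousLinearMap T‖

/-- The standard orthonormal basis vectors of `ℝⁿ`, as a set. -/
def stdBasisSet (n : ℕ) : Set (Euc n) :=
  Set.range fun i : Fin n => (EuclideanSpace.single i (1 : ℝ) : Euc n)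

/-- The basis-enriched random polytope `absconv{e₁,…,eₙ, x₁/√n,…,x_m/√n}`. -/
def enrichedBody (n m : ℕ) (x : Fin m → Euc n) : Set (Euc n) :=
  absConv n (stdBasisSet n ∪ Set.range fun j => (Real.sqrt n)⁻¹ • x j)

/-- `s_k(T) ≥ 1`, via the Courant–Fischer characterization of singular values. -/
def SingValGe (n : ℕ) (T : Euc n →ₗ[ℝ] Euc n) (k : ℕ) : Prop :=
  ∃ F : Submodule ℝ (Euc n), k ≤ Module.finrank ℝ F ∧ ∀ x ∈ F, ‖x‖ ≤ ‖T x‖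

/-- A `(k,β)`-mixing operator. -/
def IsMixing (n : ℕ) (T : Euc n →ₗ[ℝ] Euc n) (k : ℕ) (β : ℝ) : Prop :=
  ∃ E : Submodule ℝ (Euc n), k ≤ Module.finrank ℝ E ∧
    ∀ x ∈ E, β * ‖x‖ ≤ ‖Submodule.orthogonalProjectionOnto Eᗮ (T x)‖

/-- The basis constant of the normed space with unit ball `K`. -/
def basisConstant (n : ℕ) (K : Set (Euc n)) : ℝ :=
  sInf {c : ℝ | 0 < c ∧ ∃ b : Module.Basis (Fin n) ℝ (Euc n),
    ∀ k : ℕ, k ≤ n → ∀ lam : Fin n → ℝ,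
      gauge K (∑ i ∈ Finset.univ.filter (fun i : Fin n => (i : ℕ) < k), lam i • b i) ≤
        c * gauge K (∑ i, lam i • b i)}

/-- The polar body. -/
def polarBody (n : ℕ) (B : Set (Euc n)) : Set (Euc n) :=
  {y | ∀ x ∈ B, ⟪x, y⟫ ≤ 1}

/-- The 1-summing norm of the identity `I : X_B* → ℓ₂ⁿ`. -/
def piOneId (n : ℕ) (B : Set (Euc n)) : ℝ :=
  sInf {α : ℝ | 0 < α ∧ ∀ N : ℕ, ∀ z : Fin N → Euc n,
    ∑ j, ‖z j‖ ≤ α * sSup ((fun y => ∑ j, |⟪y, z j⟫|) '' B)}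

/-- The normed space with unit ball `L` admits a `1`-unconditional basis. -/
def HasOneUncondBasis (n : ℕ) (L : Set (Euc n)) : Prop :=
  ∃ b : Module.Basis (Fin n) ℝ (Euc n), ∀ lam : Fin n → ℝ,
    gauge L (∑ i, lam i • b i) = gauge L (∑ i, |lam i| • b i)


lemma bm1 (A B C : Set ℝ) (hA : MeasurableSet A) (hB : MeasurableSet B) (hAn : A.Nonempty)
    (hBn : B.Nonempty) (a b : ℝ) (ha : 0 < a) (hb : 0 < b)
    (h : ∀ x ∈ A, ∀ y ∈ B, a * x + b * y ∈ C) :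
    ENNReal.ofReal a * volume A + ENNReal.ofReal b * volume B ≤ volume C := by
  have key : ∀ K ⊆ A, IsCompact K → K.Nonempty → ∀ L ⊆ B, IsCompact L → L.Nonempty →
      ENNReal.ofReal a * volume K + ENNReal.ofReal b * volume L ≤ volume C := by
    intro K hKA hK hKn L hLB hL hLn
    obtain ⟨k, hk, hk'⟩ := hK.exists_isGreatest hKn
    obtain ⟨l, hl, hl'⟩ := hL.exists_isLeast hLn
    have e1 : volume ((fun x => b * l + x) '' ((fun x => a * x) '' K)) = ENNReal.ofReal a * volume K := by
      rw [Set.image_add_left, measure_preimage_add]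
      have := Measure.addHaar_smul (volume : Measure ℝ) a K
      simpa [abs_of_pos ha, Set.image_smul, smul_eq_mul, ← Set.image_smul] using this
    have e2 : volume ((fun x => a * k + x) '' ((fun x => b * x) '' L)) = ENNReal.ofReal b * volume L := by
      rw [Set.image_add_left, measure_preimage_add]
      have := Measure.addHaar_smul (volume : Measure ℝ) b L
      simpa [abs_of_pos hb, Set.image_smul, smul_eq_mul, ← Set.image_smul] using this
    rw [← e1, ← e2, ← measure_union₀]
    · apply measure_mono
      rintro z (⟨_, ⟨x, hx, rfl⟩, rfl⟩ | ⟨_, ⟨x, hx, rfl⟩, rfl⟩)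
      · have := h x (hKA hx) l (hLB hl)
        simpa [add_comm] using this
      · exact h k (hKA hk) x (hLB hx)
    · apply IsCompact.measurableSet _ |>.nullMeasurableSet
      exact (hL.image (by fun_prop)).image (by fun_prop)
    · apply measure_mono_null (t := {a * k + b * l}) _ (by simp)
      rintro z ⟨⟨_, ⟨x, hx, rfl⟩, rfl⟩, ⟨_, ⟨y, hy, rfl⟩, h2⟩⟩
      have h1 := hk' hx
      have h3 := hl' hy
      simp only [Set.mem_singleton_iff] at *
      have := mul_le_mul_of_nonneg_left h1 ha.le
      have := mul_le_mul_of_nonneg_left h3 hb.le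
      linarith
  -- inner regularity
  obtain ⟨a0, ha0⟩ := hAn
  obtain ⟨b0, hb0⟩ := hBn
  rw [hA.measure_eq_iSup_isCompact, hB.measure_eq_iSup_isCompact]
  simp only [ENNReal.mul_iSup]
  have : ∀ (p : Set ℝ), p ⊆ A → IsCompact p → ∀ q ⊆ B, IsCompact q →
    ENNReal.ofReal a * volume p + ENNReal.ofReal b * volume q ≤ volume C := by
    intro p hp hpc q hq hqc
    refine le_trans ?_ (key (insert a0 p) (Set.insert_subset ha0 hp) (hpc.insert _) (by simp)
      (insert b0 q) (Set.insert_subset hb0 hq) (hqc.insert _) (by simp))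
    gcongr <;> simp
  refine ENNReal.biSup_add_biSup_le' (f := fun p : Set ℝ => ⨆ (_ : IsCompact p), ENNReal.ofReal a * volume p) (p := fun p => p ⊆ A) (q := fun p => p ⊆ B) (g := fun p : Set ℝ => ⨆ (_ : IsCompact p), ENNReal.ofReal b * volume p) ⟨∅, by simp⟩ ⟨∅, by simp⟩ ?_
  intro p hp q hq
  by_cases hpc : IsCompact p
  · by_cases hqc : IsCompact q
    · simpa [hpc, hqc] using this p hp hpc q hq hqc
    · simpa [hpc, hqc] using this p hp hpc ∅ (by simp) (by simp)
  · by_cases hqc : IsCompact q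
    · simpa [hpc, hqc] using this ∅ (by simp) (by simp) q hq hqc
    · simp [hpc, hqc]

/-- one dimensional Prekopa-Leindler, bounded normalized version -/
lemma pl1_norm (f g h : ℝ → ℝ) (hf : Measurable f) (hg : Measurable g) (hh : Measurable h)
    (f0 : ∀ x, 0 ≤ f x) (g0 : ∀ x, 0 ≤ g x) (h0 : ∀ x, 0 ≤ h x)
    (f1 : ∀ x, f x ≤ 1) (g1 : ∀ x, g x ≤ 1)
    (f2 : ∀ t < 1, ∃ x, t < f x) (g2 : ∀ t < 1, ∃ x, t < g x)
    (a b : ℝ) (ha : 0 < a) (hb : 0 < b) (hab : a + b = 1)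
    (H : ∀ x y t, 0 < t → t < f x → t < g y → t < h (a * x + b * y)) :
    ENNReal.ofReal a * (∫⁻ x, ENNReal.ofReal (f x)) + ENNReal.ofReal b * ∫⁻ x, ENNReal.ofReal (g x)
      ≤ ∫⁻ x, ENNReal.ofReal (h x) := by
  rw [lintegral_eq_lintegral_meas_lt _ (.of_forall f0) hf.aemeasurable,
    lintegral_eq_lintegral_meas_lt _ (.of_forall g0) hg.aemeasurable,
    lintegral_eq_lintegral_meas_lt _ (.of_forall h0) hh.aemeasurable]
  rw [← lintegral_const_mul' _ _ ENNReal.ofReal_ne_top, ← lintegral_const_mul' _ _ ENNReal.ofReal_ne_top]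
  rw [← lintegral_add_left]
  · apply setLIntegral_mono' measurableSet_Ioi
    intro t ht
    rcases lt_or_ge t 1 with h1 | h1
    · apply bm1 _ _ _ (hf measurableSet_Ioi) (hg measurableSet_Ioi) (f2 t h1) (g2 t h1) a b ha hb
      intro x hx y hy
      exact H x y t ht hx hy
    · have e1 : {x | t < f x} = ∅ := by ext x; simpa using (f1 x).trans h1
      have e2 : {x | t < g x} = ∅ := by ext x; simpa using (g1 x).trans h1
      simp [e1, e2]
  · apply Measurable.const_mul
    apply Antitone.measurable
    intro s t hst
    exact measure_mono fun x hx => lt_of_le_of_lt hst hx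

lemma amgm_ennreal (x y : ℝ≥0∞) (a b : ℝ) (ha : 0 < a) (hb : 0 < b) (hab : a + b = 1) :
    x ^ a * y ^ b ≤ ENNReal.ofReal a * x + ENNReal.ofReal b * y := by
  have ha' : ENNReal.ofReal a ≠ 0 := by simpa using ha
  have hb' : ENNReal.ofReal b ≠ 0 := by simpa using hb
  by_cases hx : x = ⊤
  · simp [hx, ENNReal.mul_top ha']
  by_cases hy : y = ⊤
  · simp [hy, ENNReal.mul_top hb']
  lift x to NNReal using hx
  lift y to NNReal using hy
  have := NNReal.geom_mean_le_arith_mean2_weighted a.toNNReal b.toNNReal x y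
    (by rw [← Real.toNNReal_add ha.le hb.le, hab]; simp)
  rw [← ENNReal.coe_rpow_of_nonneg _ ha.le, ← ENNReal.coe_rpow_of_nonneg _ hb.le]
  simp only [Real.coe_toNNReal _ ha.le, Real.coe_toNNReal _ hb.le] at this
  simp only [ENNReal.ofReal]
  exact_mod_cast this

lemma pl1_bdd (f g h : ℝ → ℝ≥0∞) (hf : Measurable f) (hg : Measurable g) (hh : Measurable h)
    (M N : ℝ≥0∞) (hM : M ≠ ⊤) (hN : N ≠ ⊤) (hfM : ∀ x, f x ≤ M) (hgN : ∀ x, g x ≤ N)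
    (a b : ℝ) (ha : 0 < a) (hb : 0 < b) (hab : a + b = 1)
    (H : ∀ x y, f x ^ a * g y ^ b ≤ h (a * x + b * y)) :
    (∫⁻ x, f x) ^ a * (∫⁻ x, g x) ^ b ≤ ∫⁻ x, h x := by
  set α := ⨆ x, f x with hα
  set β := ⨆ x, g x with hβ
  have fα : ∀ x, f x ≤ α := fun x => le_iSup f x
  have gβ : ∀ x, g x ≤ β := fun x => le_iSup g x
  have αt : α ≠ ⊤ := ne_top_of_le_ne_top hM (iSup_le hfM)
  have βt : β ≠ ⊤ := ne_top_of_le_ne_top hN (iSup_le hgN)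
  by_cases α0 : α = 0
  · have : ∀ x, f x = 0 := fun x => le_antisymm (α0 ▸ fα x) bot_le
    simp [this, ENNReal.zero_rpow_of_pos ha]
  by_cases β0 : β = 0
  · have : ∀ x, g x = 0 := fun x => le_antisymm (β0 ▸ gβ x) bot_le
    simp [this, ENNReal.zero_rpow_of_pos hb]
  set γ := α ^ a * β ^ b with hγ
  have γ0 : γ ≠ 0 := by
    simp only [hγ, ne_eq, mul_eq_zero, not_or]
    exact ⟨(ENNReal.rpow_pos (pos_iff_ne_zero.2 α0) αt).ne', (ENNReal.rpow_pos (pos_iff_ne_zero.2 β0) βt).ne'⟩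
  have γt : γ ≠ ⊤ := ENNReal.mul_ne_top (ENNReal.rpow_ne_top_of_nonneg ha.le αt) (ENNReal.rpow_ne_top_of_nonneg hb.le βt)
  have ft : ∀ x, f x / α ≤ 1 := fun x => ENNReal.div_le_of_le_mul (by simpa using fα x)
  have gt : ∀ x, g x / β ≤ 1 := fun x => ENNReal.div_le_of_le_mul (by simpa using gβ x)
  have ft' : ∀ x, f x / α ≠ ⊤ := fun x => ne_top_of_le_ne_top ENNReal.one_ne_top (ft x)
  have gt' : ∀ x, g x / β ≠ ⊤ := fun x => ne_top_of_le_ne_top ENNReal.one_ne_top (gt x)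
  have ht' : ∀ x, min (h x / γ) 1 ≠ ⊤ := fun x => ne_top_of_le_ne_top ENNReal.one_ne_top (min_le_right _ _)
  have sup_aux : ∀ (f : ℝ → ℝ≥0∞) (α : ℝ≥0∞), α = ⨆ x, f x → α ≠ 0 → α ≠ ⊤ → (∀ x, f x / α ≠ ⊤) →
      ∀ t < 1, ∃ x, t < (f x / α).toReal := by
    intro f α hα α0 αt ft' t ht
    have h1 : ENNReal.ofReal t * α < α := by
      calc ENNReal.ofReal t * α < 1 * α := by
            apply ENNReal.mul_lt_mul_left α0 αt
            simpa using ht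
        _ = α := one_mul _
    conv_rhs at h1 => rw [hα]
    obtain ⟨x, hx⟩ := lt_iSup_iff.1 h1
    refine ⟨x, ?_⟩
    rcases lt_or_ge t 0 with h0 | h0
    · exact h0.trans_le ENNReal.toReal_nonneg
    rw [← ENNReal.ofReal_lt_iff_lt_toReal h0 (ft' x)]
    rw [ENNReal.lt_div_iff_mul_lt (Or.inl α0) (Or.inl αt)]
    exact hx
  have γinv : γ⁻¹ = (α ^ a)⁻¹ * (β ^ b)⁻¹ := by
    rw [hγ]
    apply ENNReal.mul_inv
    · right; exact (ENNReal.rpow_ne_top_of_nonneg hb.le βt)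
    · left; exact (ENNReal.rpow_ne_top_of_nonneg ha.le αt)
  have := pl1_norm (fun x => (f x / α).toReal) (fun x => (g x / β).toReal)
    (fun x => (min (h x / γ) 1).toReal) (by fun_prop) (by fun_prop) (by fun_prop)
    (fun _ => ENNReal.toReal_nonneg) (fun _ => ENNReal.toReal_nonneg) (fun _ => ENNReal.toReal_nonneg)
    (fun x => by simpa using ENNReal.toReal_mono ENNReal.one_ne_top (ft x))
    (fun x => by simpa using ENNReal.toReal_mono ENNReal.one_ne_top (gt x))
    (sup_aux f α hα α0 αt ft') (sup_aux g β hβ β0 βt gt') a b ha hb hab ?_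
  · simp only [ENNReal.ofReal_toReal (ft' _), ENNReal.ofReal_toReal (gt' _), ENNReal.ofReal_toReal (ht' _)] at this
    have h2 := (amgm_ennreal _ _ a b ha hb hab).trans this
    have h3 : ∫⁻ x, min (h x / γ) 1 ≤ (∫⁻ x, h x) / γ := by
      simp only [div_eq_mul_inv]
      rw [← lintegral_mul_const' _ _ (by simpa using γ0)]
      exact lintegral_mono fun x => min_le_left _ _
    have h4 := h2.trans h3
    simp only [div_eq_mul_inv] at h4
    rw [lintegral_mul_const' _ _ (by simpa using α0), lintegral_mul_const' _ _ (by simpa using β0),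
      ENNReal.mul_rpow_of_nonneg _ _ ha.le, ENNReal.mul_rpow_of_nonneg _ _ hb.le] at h4
    rw [ENNReal.inv_rpow, ENNReal.inv_rpow, mul_mul_mul_comm, ← γinv] at h4
    calc _ = (∫⁻ x, f x) ^ a * (∫⁻ x, g x) ^ b * γ⁻¹ * γ := by
          rw [mul_assoc _ γ⁻¹, ENNReal.inv_mul_cancel γ0 γt, mul_one]
      _ ≤ (∫⁻ x, h x) * γ⁻¹ * γ := by gcongr
      _ = _ := by rw [mul_assoc _ γ⁻¹, ENNReal.inv_mul_cancel γ0 γt, mul_one]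
  · intro x y t ht hx hy
    have t1 : t < 1 := hx.trans_le (by simpa using ENNReal.toReal_mono ENNReal.one_ne_top (ft x))
    rw [← ENNReal.ofReal_lt_iff_lt_toReal ht.le (ft' x)] at hx
    rw [← ENNReal.ofReal_lt_iff_lt_toReal ht.le (gt' y)] at hy
    rw [← ENNReal.ofReal_lt_iff_lt_toReal ht.le (ht' _)]
    refine lt_min ?_ (by simpa using t1)
    calc ENNReal.ofReal t = ENNReal.ofReal t ^ a * ENNReal.ofReal t ^ b := by
          rw [← ENNReal.rpow_add _ _ (by simpa using ht) (by simp), hab, ENNReal.rpow_one]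
      _ < (f x / α) ^ a * (g y / β) ^ b :=
          ENNReal.mul_lt_mul (ENNReal.rpow_lt_rpow hx ha) (ENNReal.rpow_lt_rpow hy hb)
      _ = f x ^ a * g y ^ b / γ := by
          rw [div_eq_mul_inv, div_eq_mul_inv, div_eq_mul_inv,
            ENNReal.mul_rpow_of_nonneg _ _ ha.le, ENNReal.mul_rpow_of_nonneg _ _ hb.le,
            ENNReal.inv_rpow, ENNReal.inv_rpow, mul_mul_mul_comm, ← γinv]
      _ ≤ _ := by
          gcongr
          exact H x y

lemma pl1 (f g h : ℝ → ℝ≥0∞) (hf : Measurable f) (hg : Measurable g) (hh : Measurable h)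
    (a b : ℝ) (ha : 0 < a) (hb : 0 < b) (hab : a + b = 1)
    (H : ∀ x y, f x ^ a * g y ^ b ≤ h (a * x + b * y)) :
    (∫⁻ x, f x) ^ a * (∫⁻ x, g x) ^ b ≤ ∫⁻ x, h x := by
  have key : ∀ M N : ℕ, (∫⁻ x, min (f x) M) ^ a * (∫⁻ x, min (g x) N) ^ b ≤ ∫⁻ x, h x := by
    intro M N
    apply pl1_bdd _ _ _ (by fun_prop) (by fun_prop) hh M N (by simp) (by simp) (fun x => min_le_right _ _) (fun x => min_le_right _ _) a b ha hb hab
    intro x y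
    refine le_trans ?_ (H x y)
    gcongr <;> simp
  have lim : ∀ f : ℝ → ℝ≥0∞, Measurable f → ∫⁻ x, f x = ⨆ M : ℕ, ∫⁻ x, min (f x) M := by
    intro f hf
    rw [← lintegral_iSup (by fun_prop)]
    · congr 1
      ext x
      apply le_antisymm
      · by_cases hx : f x = ⊤
        · simp [hx, ENNReal.iSup_natCast]
        · obtain ⟨N, hN⟩ := ENNReal.exists_nat_gt hx
          refine le_trans ?_ (le_iSup _ N)
          simp [hN.le]
      · exact iSup_le fun i => min_le_left _ _
    · intro M N hMN x
      simp only
      gcongr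
  have rs : ∀ (u : ℕ → ℝ≥0∞) (a : ℝ), 0 < a → (⨆ i, u i) ^ a = ⨆ i, u i ^ a := by
    intro u a ha
    exact (ENNReal.orderIsoRpow a ha).map_iSup u
  rw [lim f hf, lim g hg, rs _ _ ha, rs _ _ hb, ENNReal.iSup_mul]
  refine iSup_le fun M => ?_
  rw [ENNReal.mul_iSup]
  exact iSup_le fun N => key M N



/-- log-concavity for `ℝ≥0∞`-valued functions -/
def LC {E : Type*} [AddCommGroup E] [Module ℝ E] (F : E → ℝ≥0∞) : Prop :=
  ∀ x y : E, ∀ a b : ℝ, 0 < a → 0 < b → a + b = 1 → F x ^ a * F y ^ b ≤ F (a • x + b • y)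

lemma LC.convex {E : Type*} [AddCommGroup E] [Module ℝ E] {F : E → ℝ≥0∞} (h : LC F) (t : ℝ≥0∞) :
    Convex ℝ (F ⁻¹' Ioi t) := by
  rw [convex_iff_forall_pos]
  intro x hx y hy a b ha hb hab
  have : t < min (F x) (F y) := lt_min hx hy
  refine this.trans_le ?_
  refine le_trans ?_ (h x y a b ha hb hab)
  calc min (F x) (F y) = min (F x) (F y) ^ a * min (F x) (F y) ^ b := by
        rw [← ENNReal.rpow_add_of_nonneg _ _ ha.le hb.le, hab, ENNReal.rpow_one]
    _ ≤ _ := by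
        gcongr
        · exact min_le_left _ _
        · exact min_le_right _ _

lemma LC.measurable {F : ℝ → ℝ≥0∞} (h : LC F) : Measurable F :=
  measurable_of_Ioi fun t => (h.convex t).ordConnected.measurableSet

lemma LC.aemeasurable {E : Type*} [NormedAddCommGroup E] [NormedSpace ℝ E] [MeasurableSpace E]
    [BorelSpace E] [FiniteDimensional ℝ E] (μ : Measure E) [μ.IsAddHaarMeasure]
    {F : E → ℝ≥0∞} (h : LC F) : AEMeasurable F μ := by
  have : NullMeasurable F μ :=
    measurable_of_Ioi (δ := NullMeasurableSpace E μ) fun t => (h.convex t).nullMeasurableSet μ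
  exact this.aemeasurable

lemma LC.comp {E E' : Type*} [AddCommGroup E] [Module ℝ E] [AddCommGroup E'] [Module ℝ E']
    {F : E → ℝ≥0∞} (h : LC F) (T : E' →ₗ[ℝ] E) : LC (fun x => F (T x)) := by
  intro x y a b ha hb hab
  simpa using h (T x) (T y) a b ha hb hab

lemma marginal (n : ℕ) : ∀ F : (Fin (n + 1) → ℝ) → ℝ≥0∞, LC F → ∃ G : ℝ → ℝ≥0∞, LC G ∧
    ∀ φ : ℝ → ℝ≥0∞, Measurable φ → ∫⁻ x, φ (x 0) * F x = ∫⁻ t, φ t * G t := by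
  induction n with
  | zero =>
    intro F hF
    refine ⟨fun t => F (fun _ => t), ?_, ?_⟩
    · intro x y a b ha hb hab
      exact hF (fun _ => x) (fun _ => y) a b ha hb hab
    · intro φ hφ
      have := (volume_preserving_funUnique (Fin 1) ℝ).symm.lintegral_comp_emb
        (MeasurableEquiv.measurableEmbedding _) (fun x => φ (x 0) * F x)
      refine this.symm.trans ?_
      rfl
  | succ n ih =>
    intro F hF
    set F' : (Fin (n + 1) → ℝ) → ℝ≥0∞ := fun x => ∫⁻ t, F ((Fin.last (n+1)).insertNth (α := fun _ => ℝ) t x) with hF'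
    have hlin : ∀ (x y : Fin (n+1) → ℝ) (s t a b : ℝ), 
        a • ((Fin.last (n+1)).insertNth (α := fun _ => ℝ) s x) + b • ((Fin.last (n+1)).insertNth (α := fun _ => ℝ) t y)
        = ((Fin.last (n+1)).insertNth (α := fun _ => ℝ) (a * s + b * t) (a • x + b • y)) := by
      intro x y s t a b
      ext i
      refine Fin.lastCases ?_ (fun j => ?_) i
      · simp
      · simp [Fin.insertNth_last]
    have hsl : ∀ x, LC (fun t => F ((Fin.last (n+1)).insertNth (α := fun _ => ℝ) t x)) := by
      intro x s t a b ha hb hab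
      have := hF ((Fin.last (n+1)).insertNth (α := fun _ => ℝ) s x) ((Fin.last (n+1)).insertNth (α := fun _ => ℝ) t x) a b ha hb hab
      rw [hlin, ← add_smul, hab, one_smul] at this
      exact this
    have hLC : LC F' := by
      intro x y a b ha hb hab
      apply pl1 _ _ _ (hsl x).measurable (hsl y).measurable (hsl _).measurable a b ha hb hab
      intro s t
      rw [← hlin]
      exact hF _ _ a b ha hb hab
    obtain ⟨G, hG, hG2⟩ := ih F' hLC
    refine ⟨G, hG, fun φ hφ => ?_⟩
    rw [← hG2 φ hφ]
    have mp := (volume_preserving_piFinSuccAbove (fun _ : Fin (n+2) => ℝ) (Fin.last (n+1))).symm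
    have := mp.lintegral_comp_emb
        (MeasurableEquiv.measurableEmbedding _) (fun x => φ (x 0) * F x)
    rw [← this]
    have hae : AEMeasurable F volume := hF.aemeasurable volume
    have hae2 : AEMeasurable (fun x : Fin (n+2) → ℝ => φ (x 0) * F x) volume := by
      apply AEMeasurable.mul _ hae
      exact (hφ.comp (measurable_pi_apply 0)).aemeasurable
    have hae3 := hae2.comp_quasiMeasurePreserving mp.quasiMeasurePreserving
    refine (lintegral_prod_symm _ hae3).trans ?_
    apply lintegral_congr
    intro x
    simp only [hF']
    rw [← lintegral_const_mul _ (hsl x).measurable]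
    apply lintegral_congr
    intro t
    simp only [Function.comp, MeasurableEquiv.piFinSuccAbove_symm_apply, Fin.insertNthEquiv_apply]
    congr 2


lemma lc_tail_right (G : ℝ → ℝ≥0∞) (hG : LC G) (h1 : ∫⁻ t, G t = 1)
    (h2 : ∫⁻ t, ENNReal.ofReal (t ^ 2) * G t ≤ 1) (t : ℝ) (ht : 10 < t) :
    G t ≤ ENNReal.ofReal (Real.exp (-(t - 2) / 20)) := by
  have hm := hG.measurable
  have cheb : ∫⁻ t in {t : ℝ | 2 ≤ |t|}, G t ≤ 1 / 4 := by
    have hms : MeasurableSet {t : ℝ | 2 ≤ |t|} := measurableSet_le measurable_const (by fun_prop)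
    have : ∫⁻ t in {t : ℝ | 2 ≤ |t|}, 4 * G t ≤ 1 := by
      refine le_trans ?_ h2
      refine le_trans ?_ (setLIntegral_le_lintegral {t : ℝ | 2 ≤ |t|} _)
      apply setLIntegral_mono' hms
      intro x hx
      gcongr
      have : (4 : ℝ≥0∞) = ENNReal.ofReal 4 := by norm_num
      rw [this]
      apply ENNReal.ofReal_le_ofReal
      have hx' : (2:ℝ) ≤ |x| := hx
      rw [← sq_abs]
      nlinarith
    rw [lintegral_const_mul' _ _ (by norm_num)] at this
    rw [ENNReal.le_div_iff_mul_le (by norm_num) (by norm_num), mul_comm]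
    exact this
  have ha : ∃ a ∈ Icc (-2 : ℝ) 2, (1 / 8 : ℝ≥0∞) ≤ G a := by
    by_contra hcon
    push Not at hcon
    have e : ∫⁻ t, G t ≤ (∫⁻ t in Icc (-2 : ℝ) 2, G t) + ∫⁻ t in {t : ℝ | 2 ≤ |t|}, G t := by
      refine le_trans ?_ (lintegral_union_le _ _ _)
      rw [← setLIntegral_univ]
      apply lintegral_mono_set
      intro x _
      rcases le_total 2 |x| with h | h
      · right; exact h
      · left; exact abs_le.1 h
    have e2 : ∫⁻ t in Icc (-2 : ℝ) 2, G t ≤ ∫⁻ t in Icc (-2 : ℝ) 2, (1 / 8 : ℝ≥0∞) :=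
      setLIntegral_mono' measurableSet_Icc fun x hx => (hcon x hx).le
    rw [setLIntegral_const, Real.volume_Icc] at e2
    have e3 := e.trans (add_le_add e2 cheb)
    rw [h1] at e3
    have : (1 / 8 : ℝ≥0∞) * ENNReal.ofReal (2 - -2) + 1 / 4 = ENNReal.ofReal (3 / 4) := by
      rw [show (1 / 8 : ℝ≥0∞) = ENNReal.ofReal (1 / 8) by
        rw [ENNReal.ofReal_div_of_pos (by norm_num)]; norm_num,
        show (1 / 4 : ℝ≥0∞) = ENNReal.ofReal (1 / 4) by
        rw [ENNReal.ofReal_div_of_pos (by norm_num)]; norm_num,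
        ← ENNReal.ofReal_mul (by norm_num), ← ENNReal.ofReal_add (by norm_num) (by norm_num)]
      norm_num
    rw [this] at e3
    have h' : (1 : ℝ) ≤ 3 / 4 := by simpa using e3
    norm_num at h'
  have hb : ∃ b ∈ Icc (2 : ℝ) 10, G b ≤ (1 / 16 : ℝ≥0∞) := by
    by_contra hcon
    push Not at hcon
    have e2 : ∫⁻ t in Icc (2 : ℝ) 10, (1 / 16 : ℝ≥0∞) ≤ ∫⁻ t in Icc (2 : ℝ) 10, G t :=
      setLIntegral_mono' measurableSet_Icc fun x hx => (hcon x hx).le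
    have e1 : ∫⁻ t in Icc (2 : ℝ) 10, G t ≤ ∫⁻ t in {t : ℝ | 2 ≤ |t|}, G t :=
      lintegral_mono_set fun x hx => hx.1.trans (le_abs_self x)
    rw [setLIntegral_const, Real.volume_Icc] at e2
    have e3 := (e2.trans e1).trans cheb
    rw [show (1 / 16 : ℝ≥0∞) = ENNReal.ofReal (1 / 16) by
        rw [ENNReal.ofReal_div_of_pos (by norm_num)]; norm_num,
        show (1 / 4 : ℝ≥0∞) = ENNReal.ofReal (1 / 4) by
        rw [ENNReal.ofReal_div_of_pos (by norm_num)]; norm_num,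
        ← ENNReal.ofReal_mul (by norm_num), ENNReal.ofReal_le_ofReal_iff (by norm_num)] at e3
    norm_num at e3
  obtain ⟨a, ⟨ha1, ha2⟩, ha3⟩ := ha
  obtain ⟨b, ⟨hb1, hb2⟩, hb3⟩ := hb
  have hab : a < b := by
    rcases lt_or_eq_of_le (ha2.trans hb1) with h | h
    · exact h
    · rw [h] at ha3
      have := ha3.trans hb3
      rw [show (1 / 16 : ℝ≥0∞) = ENNReal.ofReal (1 / 16) by
        rw [ENNReal.ofReal_div_of_pos (by norm_num)]; norm_num,
        show (1 / 8 : ℝ≥0∞) = ENNReal.ofReal (1 / 8) by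
        rw [ENNReal.ofReal_div_of_pos (by norm_num)]; norm_num, ENNReal.ofReal_le_ofReal_iff (by norm_num)] at this
      norm_num at this
  set l := (b - a) / (t - a) with hl
  have hta : 0 < t - a := by linarith
  have l0 : 0 < l := div_pos (by linarith) hta
  have l1 : l < 1 := by rw [hl, div_lt_one hta]; linarith
  have hc := hG a t (1 - l) l (by linarith) l0 (by ring)
  have hpt : (1 - l) • a + l • t = b := by
    have : l * (t - a) = b - a := by rw [hl]; field_simp
    simp only [smul_eq_mul]; linarith
  rw [hpt] at hc
  have h3 : ENNReal.ofReal ((1/8) ^ (1 - l)) * G t ^ l ≤ ENNReal.ofReal (1 / 16) := by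
    calc ENNReal.ofReal ((1/8) ^ (1 - l)) * G t ^ l ≤ G a ^ (1 - l) * G t ^ l := by
          gcongr
          rw [← ENNReal.ofReal_rpow_of_pos (by norm_num)]
          apply ENNReal.rpow_le_rpow _ (by linarith)
          · rwa [show (1 / 8 : ℝ≥0∞) = ENNReal.ofReal (1 / 8) by
              rw [ENNReal.ofReal_div_of_pos (by norm_num)]; norm_num] at ha3
      _ ≤ _ := hc
      _ ≤ _ := hb3
      _ = _ := by rw [ENNReal.ofReal_div_of_pos (by norm_num)]; norm_num
  have h4 : G t ^ l ≤ ENNReal.ofReal (1 / 2 * (1 / 8) ^ l) := by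
    have p1 : (0:ℝ) < (1/8) ^ (1 - l) := by positivity
    have : G t ^ l ≤ ENNReal.ofReal (1 / 16) / ENNReal.ofReal ((1/8) ^ (1 - l)) := by
      rw [ENNReal.le_div_iff_mul_le (Or.inl (by simpa using p1)) (Or.inl (by simp)), mul_comm]
      exact h3
    rw [← ENNReal.ofReal_div_of_pos p1] at this
    refine this.trans (le_of_eq ?_)
    congr 1
    rw [Real.rpow_sub (by norm_num), Real.rpow_one]
    field_simp
    norm_num
  have h5 : G t = (G t ^ l) ^ (1 / l) := by
    rw [← ENNReal.rpow_mul, mul_one_div_cancel l0.ne', ENNReal.rpow_one]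
  rw [h5]
  calc (G t ^ l) ^ (1 / l) ≤ ENNReal.ofReal (1 / 2 * (1 / 8) ^ l) ^ (1 / l) := by gcongr
    _ = ENNReal.ofReal ((1 / 2 * (1 / 8) ^ l) ^ (1 / l)) := by
        rw [ENNReal.ofReal_rpow_of_pos (by positivity)]
    _ ≤ _ := by
        apply ENNReal.ofReal_le_ofReal
        rw [Real.mul_rpow (by norm_num) (by positivity), ← Real.rpow_mul (by norm_num),
          mul_one_div_cancel l0.ne', Real.rpow_one]
        have h6 : (t - 2) / 12 ≤ 1 / l := by
          rw [hl, one_div_div, div_le_div_iff₀ (by norm_num) (by linarith)]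
          nlinarith
        have h7 : (1 / 2 : ℝ) ^ (1 / l) ≤ Real.exp (-(t - 2) / 20) := by
          rw [Real.rpow_def_of_pos (by norm_num)]
          apply Real.exp_le_exp.2
          have : Real.log (1 / 2) ≤ - (12 / 20) := by
            rw [one_div, Real.log_inv]
            have := Real.log_two_gt_d9
            linarith
          have h8 : 0 ≤ 1 / l := by positivity
          nlinarith
        have := Real.exp_pos (-(t - 2) / 20)
        nlinarith [Real.rpow_nonneg (show (0:ℝ) ≤ 1/2 by norm_num) (1 / l)]

lemma lc_exp_bound : ∃ M : ℝ, 1 ≤ M ∧ ∀ G : ℝ → ℝ≥0∞, LC G → ∫⁻ t, G t = 1 →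
    ∫⁻ t, ENNReal.ofReal (t ^ 2) * G t ≤ 1 →
    ∫⁻ t, ENNReal.ofReal (Real.exp (|t| / 40)) * G t ≤ ENNReal.ofReal M := by
  have hint : Integrable (fun t : ℝ => Real.exp (1 / 10 - |t| / 40)) := by
    have h0 : Integrable (fun t : ℝ => 3200 * Real.exp (1/10) * (1 + t ^ 2)⁻¹) := integrable_inv_one_add_sq.const_mul _
    refine h0.mono' (by fun_prop) (.of_forall fun t => ?_)
    rw [Real.norm_of_nonneg (Real.exp_pos _).le, Real.exp_sub, div_eq_mul_inv,
      mul_comm 3200, mul_assoc]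
    gcongr
    rw [← div_eq_mul_inv, inv_eq_one_div, div_le_div_iff₀ (Real.exp_pos _) (by positivity)]
    have := Real.quadratic_le_exp_of_nonneg (show 0 ≤ |t| / 40 by positivity)
    have h2 : (|t| / 40) ^ 2 = t ^ 2 / 1600 := by rw [div_pow, sq_abs]; norm_num
    rw [h2] at this
    have : 0 ≤ |t| := abs_nonneg t
    nlinarith
  set J := ∫⁻ t, ENNReal.ofReal (Real.exp (1 / 10 - |t| / 40)) with hJ
  have hJt : J ≠ ⊤ := by
    have := hint.lintegral_lt_top
    exact this.ne
  refine ⟨Real.exp (1 / 4) + J.toReal, ?_, ?_⟩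
  · have := Real.add_one_le_exp (1/4)
    have := J.toReal_nonneg
    linarith
  · intro G hG h1 h2
    have hpt : ∀ t, 10 < |t| → G t ≤ ENNReal.ofReal (Real.exp (-(|t| - 2) / 20)) := by
      intro t ht
      rcases abs_choice t with h | h
      · rw [h] at ht ⊢
        exact lc_tail_right G hG h1 h2 t ht
      · rw [h] at ht ⊢
        have hG' : LC (fun t => G (-t)) := by
          intro x y a b ha hb hab
          have := hG (-x) (-y) a b ha hb hab
          simpa [add_comm] using this
        have i1 : ∫⁻ t, G (-t) = 1 := by rw [← h1]; exact lintegral_neg_eq_self G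
        have i2 : ∫⁻ t, ENNReal.ofReal (t ^ 2) * G (-t) ≤ 1 := by
          refine le_trans (le_of_eq ?_) h2
          rw [← lintegral_neg_eq_self]
          simp
        have := lc_tail_right _ hG' i1 i2 (-t) ht
        simpa using this
    rw [ENNReal.ofReal_add (Real.exp_pos _).le J.toReal_nonneg, ENNReal.ofReal_toReal hJt]
    calc ∫⁻ t, ENNReal.ofReal (Real.exp (|t| / 40)) * G t
        ≤ ∫⁻ t, (ENNReal.ofReal (Real.exp (1 / 4)) * G t + ENNReal.ofReal (Real.exp (1 / 10 - |t| / 40))) := by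
          apply lintegral_mono
          intro t
          rcases le_or_gt |t| 10 with h | h
          · refine le_trans ?_ le_self_add
            dsimp only
            apply mul_le_mul_left
            apply ENNReal.ofReal_le_ofReal
            apply Real.exp_le_exp.2
            linarith
          · refine le_trans ?_ le_add_self
            dsimp only
            refine le_trans (mul_le_mul_right (hpt t h) _) ?_
            rw [← ENNReal.ofReal_mul (Real.exp_pos _).le, ← Real.exp_add]
            apply le_of_eq
            congr 2
            ring
      _ = _ := by
          rw [lintegral_add_left (hG.measurable.const_mul _), lintegral_const_mul _ hG.measurable, h1, mul_one]

lemma marginal_dir {n : ℕ} {μ : Measure (Euc n)} (hμ : IsIsotropicLogConcave n μ) (z : Euc n)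
    (hz : ‖z‖ = 1) : ∃ G : ℝ → ℝ≥0∞, LC G ∧ ∀ φ : ℝ → ℝ≥0∞, Measurable φ →
      ∫⁻ x, φ ⟪x, z⟫ ∂μ = ∫⁻ t, φ t * G t := by
  obtain ⟨f, f0, flc, fμ, -, -, -⟩ := hμ
  rcases n with _ | n
  · have : z = 0 := Subsingleton.elim _ _
    simp [this] at hz
  have hF : LC (fun x => ENNReal.ofReal (f x)) := by
    intro x y a b ha hb hab
    rw [ENNReal.ofReal_rpow_of_nonneg (f0 _) ha.le, ENNReal.ofReal_rpow_of_nonneg (f0 _) hb.le,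
      ← ENNReal.ofReal_mul (by have := f0 x; positivity)]
    exact ENNReal.ofReal_le_ofReal (flc x y a b ha.le hb.le hab)
  obtain ⟨b, hb⟩ := Orthonormal.exists_orthonormalBasis_extension_of_card_eq (𝕜 := ℝ) (E := Euc (n+1))
    (ι := Fin (n+1)) (by simp) (v := fun _ => z) (s := {0}) (by
      constructor
      · intro i; simpa using hz
      · intro i j hij
        exact absurd (Subsingleton.elim i j) hij)
  have hb0 : b 0 = z := hb 0 (by simp)
  let T : (Fin (n+1) → ℝ) →ₗ[ℝ] Euc (n+1) :=
    b.repr.symm.toLinearEquiv.toLinearMap ∘ₗ (WithLp.linearEquiv 2 ℝ (Fin (n+1) → ℝ)).symm.toLinearMap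
  obtain ⟨G, hG, hG2⟩ := marginal n _ (hF.comp T)
  refine ⟨G, hG, fun φ hφ => ?_⟩
  rw [← hG2 φ hφ, fμ, lintegral_withDensity_eq_lintegral_mul₀ (hF.aemeasurable _)]
  · have m1 := b.measurePreserving_repr_symm
    have m2 := (EuclideanSpace.volume_preserving_symm_measurableEquiv_toLp (Fin (n+1))).symm
    have m := m1.comp m2
    have := m.lintegral_comp_emb (by
      have := b.measurableEquiv.symm.measurableEmbedding.comp (MeasurableEquiv.toLp 2 (Fin (n+1) → ℝ)).measurableEmbedding
      exact this) (fun x => φ ⟪x, z⟫ * ENNReal.ofReal (f x))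
    simp only [Pi.mul_apply]
    simp_rw [mul_comm (ENNReal.ofReal (f _))]
    rw [← this]
    apply lintegral_congr
    intro y
    have e1 : ∀ w : Euc (n+1), ⟪b.repr.symm w, z⟫ = w 0 := by
      intro w
      rw [← hb0, real_inner_comm, ← b.repr_apply_apply]
      simp
    congr 1
    have := e1 (WithLp.toLp 2 y)
    exact congrArg φ this
  · exact (hφ.comp (by fun_prop)).aemeasurable

lemma exp_moment : ∃ M : ℝ, 1 ≤ M ∧ ∀ (n : ℕ) (μ : Measure (Euc n)), IsIsotropicLogConcave n μ →
    ∀ z : Euc n, ‖z‖ = 1 → ∫⁻ x, ENNReal.ofReal (Real.exp (|⟪x, z⟫| / 40)) ∂μ ≤ ENNReal.ofReal M := by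
  obtain ⟨M, hM, h⟩ := lc_exp_bound
  refine ⟨M, hM, fun n μ hμ z hz => ?_⟩
  obtain ⟨G, hG, hG2⟩ := marginal_dir hμ z hz
  obtain ⟨f, f0, flc, fμ, hp, hbar, hcov⟩ := hμ
  rw [hG2 (fun t => ENNReal.ofReal (Real.exp (|t| / 40))) (by fun_prop)]
  apply h G hG
  · have := hG2 (fun _ => 1) measurable_const
    simpa using this.symm
  · rw [← hG2 (fun t => ENNReal.ofReal (t ^ 2)) (by fun_prop)]
    have h1 := hcov z z
    rw [real_inner_self_eq_norm_sq, hz] at h1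
    have hi : Integrable (fun x => ⟪x, z⟫ * ⟪x, z⟫) μ := by
      by_contra hcon
      rw [integral_undef hcon] at h1
      norm_num at h1
    have := ofReal_integral_eq_lintegral_ofReal hi (.of_forall fun x => mul_self_nonneg _)
    rw [h1] at this
    simp only [pow_two]
    rw [← this]
    simp


lemma lint_pi_prod {Ω : Type*} [MeasurableSpace Ω] (μ : Measure Ω) [IsProbabilityMeasure μ] (m : ℕ)
    (g : Ω → ℝ≥0∞) (hg : Measurable g) :
    ∫⁻ x, ∏ i, g (x i) ∂(Measure.pi fun _ : Fin m => μ) = (∫⁻ x, g x ∂μ) ^ m := by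
  have hind := ProbabilityTheory.iIndepFun_pi (μ := fun _ : Fin m => μ) (X := fun _ => g)
    (fun i => hg.aemeasurable)
  have := ProbabilityTheory.lintegral_prod_eq_prod_lintegral_of_indepFun Finset.univ _ hind
    (fun i => hg.comp (measurable_pi_apply i))
  rw [this]
  have h2 : ∀ i : Fin m, ∫⁻ x, g (x i) ∂(Measure.pi fun _ : Fin m => μ) = ∫⁻ x, g x ∂μ := fun i =>
    (measurePreserving_eval (fun _ : Fin m => μ) i).lintegral_comp hg
  simp [h2]

lemma chernoff {Ω : Type*} [MeasurableSpace Ω] (μ : Measure Ω) [IsProbabilityMeasure μ] (m : ℕ)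
    (Y : Ω → ℝ) (hY : Measurable Y) (r s : ℝ) (h : ∫⁻ x, ENNReal.ofReal (Real.exp (Y x)) ∂μ ≤ ENNReal.ofReal (Real.exp r)) :
    (Measure.pi fun _ : Fin m => μ) {x | s * m ≤ ∑ i, Y (x i)} ≤ ENNReal.ofReal (Real.exp ((r - s) * m)) := by
  have h1 := meas_ge_le_lintegral_div (μ := Measure.pi fun _ : Fin m => μ)
    (f := fun x => ∏ i, ENNReal.ofReal (Real.exp (Y (x i))))
    (Finset.measurable_prod _ fun i _ => ENNReal.measurable_ofReal.comp (Real.measurable_exp.comp (hY.comp (measurable_pi_apply i)))).aemeasurable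
    (ε := ENNReal.ofReal (Real.exp (s * m))) (by simpa using Real.exp_pos _) (by simp)
  rw [lint_pi_prod μ m (fun x => ENNReal.ofReal (Real.exp (Y x))) (by fun_prop)] at h1
  have e : {x : Fin m → Ω | s * m ≤ ∑ i, Y (x i)} ⊆ {x | ENNReal.ofReal (Real.exp (s * m)) ≤ ∏ i, ENNReal.ofReal (Real.exp (Y (x i)))} := by
    intro x hx
    simp only [mem_setOf_eq] at hx ⊢
    rw [← ENNReal.ofReal_prod_of_nonneg (fun i _ => (Real.exp_pos _).le), ← Real.exp_sum]
    exact ENNReal.ofReal_le_ofReal (Real.exp_le_exp.2 hx)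
  refine (measure_mono e).trans (h1.trans ?_)
  calc _ ≤ ENNReal.ofReal (Real.exp r) ^ m / ENNReal.ofReal (Real.exp (s * m)) := by gcongr
    _ = _ := by
      rw [← ENNReal.ofReal_pow (Real.exp_pos _).le, ← ENNReal.ofReal_div_of_pos (Real.exp_pos _), ← Real.exp_nat_mul, ← Real.exp_sub]
      congr 2
      ring

lemma sphere_net (n : ℕ) (ε : ℝ) (hε : 0 < ε) : ∃ N : Finset (Euc n), (∀ w ∈ N, ‖w‖ = 1) ∧
    (N.card : ℝ) ≤ (1 + 2 / ε) ^ n ∧ ∀ z : Euc n, ‖z‖ = 1 → ∃ w ∈ N, ‖z - w‖ < ε := by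
  classical
  let P : Finset (Euc n) → Prop := fun s => (∀ w ∈ s, ‖w‖ = 1) ∧ ∀ c ∈ s, ∀ d ∈ s, c ≠ d → ε ≤ ‖c - d‖
  have card : ∀ s, P s → (s.card : ℝ) ≤ (1 + 2 / ε) ^ n := by
    rintro s ⟨hs, h⟩
    let μ : Measure (Euc n) := volume
    let δ : ℝ := ε / 2
    let ρ : ℝ := 1 + ε / 2
    have δpos : 0 < δ := by positivity
    have ρpos : 0 < ρ := by positivity
    set A := ⋃ c ∈ s, Metric.ball (c : Euc n) δ with hA
    have D : Set.Pairwise (s : Set (Euc n)) (Function.onFun Disjoint fun c => Metric.ball (c : Euc n) δ) := by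
      rintro c hc d hd hcd
      apply Metric.ball_disjoint_ball
      rw [dist_eq_norm]
      have := h c hc d hd hcd
      simp only [δ]; linarith
    have A_subset : A ⊆ Metric.ball (0 : Euc n) ρ := by
      refine iUnion₂_subset fun x hx => ?_
      apply Metric.ball_subset_ball'
      rw [dist_zero_right, hs x hx]
      simp only [δ, ρ]; linarith
    have I :
      (s.card : ℝ≥0∞) * ENNReal.ofReal (δ ^ n) * μ (Metric.ball 0 1) ≤
        ENNReal.ofReal (ρ ^ n) * μ (Metric.ball 0 1) :=
      calc
        (s.card : ℝ≥0∞) * ENNReal.ofReal (δ ^ n) * μ (Metric.ball 0 1) = μ A := by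
          rw [hA, measure_biUnion_finset D fun c _ => measurableSet_ball]
          simp only [μ.addHaar_ball_of_pos _ δpos]
          simp only [Finset.sum_const, nsmul_eq_mul, mul_assoc, finrank_euclideanSpace_fin]
        _ ≤ μ (Metric.ball (0 : Euc n) ρ) := measure_mono A_subset
        _ = ENNReal.ofReal (ρ ^ n) * μ (Metric.ball 0 1) := by
          simp only [μ.addHaar_ball_of_pos _ ρpos, finrank_euclideanSpace_fin]
    have J : (s.card : ℝ≥0∞) * ENNReal.ofReal (δ ^ n) ≤ ENNReal.ofReal (ρ ^ n) :=
      (ENNReal.mul_le_mul_iff_left (Metric.measure_ball_pos _ _ zero_lt_one).ne' measure_ball_lt_top.ne).1 I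
    have := ENNReal.toReal_le_of_le_ofReal (pow_nonneg ρpos.le _) J
    rw [ENNReal.toReal_mul, ENNReal.toReal_ofReal (by positivity)] at this
    have hcc : ((s.card : ℝ≥0∞)).toReal = (s.card : ℝ) := ENNReal.toReal_natCast _
    rw [hcc] at this
    rw [← le_div_iff₀ (by positivity), ← div_pow] at this
    have e : ρ / δ = 1 + 2 / ε := by
      change (1 + ε / 2) / (ε / 2) = 1 + 2 / ε
      field_simp
      ring
    rwa [e] at this
  have hbd : ∀ s, P s → s.card ≤ ⌊(1 + 2 / ε) ^ n⌋₊ := fun s hs => Nat.le_floor (card s hs)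
  have hne : ∃ k, ∃ s, P s ∧ s.card = k := ⟨0, ∅, by simp [P], by simp⟩
  obtain ⟨k, ⟨s, hs, hk⟩, hmax⟩ : ∃ k, (∃ s, P s ∧ s.card = k) ∧ ∀ s, P s → s.card ≤ k := by
    refine ⟨_, Nat.findGreatest_spec (P := fun k => ∃ s, P s ∧ s.card = k) (m := 0) (n := ⌊(1 + 2 / ε) ^ n⌋₊) (Nat.zero_le _) ⟨∅, by simp [P], by simp⟩, ?_⟩
    intro s hs
    exact Nat.le_findGreatest (hbd s hs) ⟨s, hs, rfl⟩
  refine ⟨s, hs.1, card s hs, fun z hz => ?_⟩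
  by_contra hcon
  push Not at hcon
  have hzs : z ∉ s := fun h => by
    have := hcon z h
    simp at this
    linarith
  have : P (insert z s) := by
    refine ⟨?_, ?_⟩
    · intro w hw
      rcases Finset.mem_insert.1 hw with rfl | h
      · exact hz
      · exact hs.1 w h
    · intro c hc d hd hcd
      rcases Finset.mem_insert.1 hc with rfl | h <;> rcases Finset.mem_insert.1 hd with rfl | h'
      · exact absurd rfl hcd
      · exact hcon d h'
      · rw [norm_sub_rev]; exact hcon c h
      · exact hs.2 c h d h' hcd
  have := hmax _ this
  rw [Finset.card_insert_of_notMem hzs] at this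
  omega

lemma second_moment {n : ℕ} {μ : Measure (Euc n)} (hμ : IsIsotropicLogConcave n μ) (z : Euc n) (hz : ‖z‖ = 1) :
    Integrable (fun x => ⟪x, z⟫ ^ 2) μ ∧ ∫ x, ⟪x, z⟫ ^ 2 ∂μ = 1 := by
  obtain ⟨f, f0, flc, fμ, hp, hbar, hcov⟩ := hμ
  have h1 := hcov z z
  rw [real_inner_self_eq_norm_sq, hz] at h1
  have hi : Integrable (fun x => ⟪x, z⟫ * ⟪x, z⟫) μ := by
    by_contra hcon
    rw [integral_undef hcon] at h1
    norm_num at h1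
  simp only [pow_two]
  exact ⟨hi, by simpa using h1⟩

lemma first_moment : ∃ c : ℝ, 0 < c ∧ c ≤ 1 ∧ ∀ (n : ℕ) (μ : Measure (Euc n)), IsIsotropicLogConcave n μ →
    ∀ z : Euc n, ‖z‖ = 1 → 
      ∫⁻ x, ENNReal.ofReal (Real.exp (-c * |⟪x, z⟫|)) ∂μ ≤ ENNReal.ofReal (Real.exp (-(c^2 / 2))) := by
  obtain ⟨M, hM, h⟩ := exp_moment
  -- |x|^3 ≤ 6*40^3 exp(|x|/40)
  set R : ℝ := 6 * 40 ^ 3 * M with hR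
  have hR0 : 1 ≤ R := by rw [hR]; nlinarith
  refine ⟨1 / (2 * R), by positivity, by rw [div_le_one (by positivity)]; linarith, fun n μ hμ z hz => ?_⟩
  have hprob : IsProbabilityMeasure μ := by obtain ⟨f, _, _, _, hp, _⟩ := hμ; exact hp
  obtain ⟨i2, e2⟩ := second_moment hμ z hz
  have hm : Measurable (fun x : Euc n => ⟪x, z⟫) := by fun_prop
  have hE : Integrable (fun x => Real.exp (|⟪x, z⟫| / 40)) μ := by
    refine ⟨by fun_prop, ?_⟩
    rw [hasFiniteIntegral_iff_ofReal (.of_forall fun x => (Real.exp_pos _).le)]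
    exact (h n μ hμ z hz).trans_lt (by simp)
  have eE : ∫ x, Real.exp (|⟪x, z⟫| / 40) ∂μ ≤ M := by
    rw [integral_eq_lintegral_of_nonneg_ae (.of_forall fun x => (Real.exp_pos _).le) (by fun_prop)]
    exact ENNReal.toReal_le_of_le_ofReal (by linarith) (h n μ hμ z hz)
  have i1 : Integrable (fun x => |⟪x, z⟫|) μ := by
    refine (i2.add (integrable_const 1)).mono' (by fun_prop) (.of_forall fun x => ?_)
    simp only [Real.norm_eq_abs, abs_abs, Pi.add_apply]
    rw [← sq_abs]
    nlinarith [sq_nonneg (|⟪x, z⟫| - 1)]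
  have pt : ∀ u : ℝ, u ^ 2 ≤ R * |u| + (6 * 40 ^ 3 * Real.exp (|u| / 40)) / (4 * R) := by
    intro u
    have h3 : |u| ^ 3 ≤ 6 * 40 ^ 3 * Real.exp (|u| / 40) := by
      have := Real.pow_div_factorial_le_exp (|u| / 40) (by positivity) 3
      have h6 : ((3).factorial : ℝ) = 6 := by norm_num [Nat.factorial]
      rw [h6, div_pow, div_div, div_le_iff₀ (by norm_num)] at this
      linarith
    have : u ^ 2 ≤ R * |u| + |u| ^ 3 / (4 * R) := by
      rw [← sq_abs u]
      have h0 := abs_nonneg u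
      have : R * |u| + |u| ^ 3 / (4 * R) - |u| ^ 2 = |u| * (2 * R - |u|) ^ 2 / (4 * R) := by
        field_simp; ring
      have h5 : 0 ≤ |u| * (2 * R - |u|) ^ 2 / (4 * R) := by positivity
      linarith
    refine this.trans ?_
    gcongr
  have hc : 1 / (2 * R) ≤ ∫ x, |⟪x, z⟫| ∂μ := by
    have := integral_mono i2 ((i1.const_mul R).add ((hE.const_mul (6 * 40 ^ 3)).div_const (4 * R))) (fun x => pt ⟪x, z⟫)
    simp only [Pi.add_apply] at this
    rw [e2, integral_add (i1.const_mul R) ((hE.const_mul (6 * 40 ^ 3)).div_const (4 * R)), integral_const_mul, integral_div, integral_const_mul] at this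
    have h8 : 6 * 40 ^ 3 * (∫ x, Real.exp (|⟪x, z⟫| / 40) ∂μ) / (4 * R) ≤ 1 / 4 := by
      rw [div_le_div_iff₀ (by positivity) (by norm_num)]
      nlinarith
    rw [div_le_iff₀ (by positivity)]
    nlinarith
  set c := 1 / (2 * R) with hcdef
  have c0 : 0 < c := by positivity
  have hexp : ∀ v : ℝ, 0 ≤ v → Real.exp (-v) ≤ 1 - v + v ^ 2 / 2 := by
    intro v hv
    have := Real.quadratic_le_exp_of_nonneg hv
    rw [Real.exp_neg, inv_le_iff_one_le_mul₀ (Real.exp_pos _)]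
    have h4 : 0 ≤ 1 - v + v ^ 2 / 2 := by nlinarith [sq_nonneg (v - 1)]
    calc 1 ≤ (1 - v + v ^ 2 / 2) * (1 + v + v ^ 2 / 2) := by nlinarith [sq_nonneg (v^2)]
      _ ≤ _ := by gcongr
  have iN : Integrable (fun x => Real.exp (-c * |⟪x, z⟫|)) μ := by
    refine (integrable_const (1:ℝ)).mono' (by fun_prop) (.of_forall fun x => ?_)
    rw [Real.norm_of_nonneg (Real.exp_pos _).le, Real.exp_le_one_iff]
    have := abs_nonneg ⟪x, z⟫
    nlinarith
  rw [← ofReal_integral_eq_lintegral_ofReal iN (.of_forall fun x => (Real.exp_pos _).le)]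
  apply ENNReal.ofReal_le_ofReal
  have := integral_mono iN (((integrable_const (1:ℝ)).sub (i1.const_mul c)).add (i2.const_mul (c ^ 2 / 2))) (fun x => by
    have := hexp (c * |⟪x, z⟫|) (by positivity)
    simp only [Pi.add_apply, Pi.sub_apply]
    rw [mul_pow, sq_abs] at this
    rw [neg_mul]
    linarith)
  simp only [Pi.add_apply, Pi.sub_apply] at this
  have hI : Integrable (fun x => 1 - c * |⟪x, z⟫|) μ := (integrable_const (1:ℝ)).sub (i1.const_mul c)
  rw [integral_add hI (i2.const_mul (c ^ 2 / 2)),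
    integral_sub (integrable_const (1:ℝ)) (i1.const_mul c), integral_const_mul, integral_const_mul, e2] at this
  simp only [integral_const, probReal_univ, smul_eq_mul, mul_one] at this
  have h9 := Real.add_one_le_exp (-(c ^ 2 / 2))
  nlinarith


def Usum {n m : ℕ} (x : Fin m → Euc n) (z : Euc n) : ℝ := ∑ i, |⟪x i, z⟫|

lemma Usum_add {n m : ℕ} (x : Fin m → Euc n) (y z : Euc n) : Usum x (y + z) ≤ Usum x y + Usum x z := by
  unfold Usum
  rw [← Finset.sum_add_distrib]
  refine Finset.sum_le_sum fun i _ => ?_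
  rw [inner_add_right]
  exact abs_add_le _ _

lemma Usum_smul {n m : ℕ} (x : Fin m → Euc n) (t : ℝ) (z : Euc n) : Usum x (t • z) = |t| * Usum x z := by
  unfold Usum
  rw [Finset.mul_sum]
  refine Finset.sum_congr rfl fun i _ => ?_
  rw [inner_smul_right, abs_mul]

lemma Usum_nonneg {n m : ℕ} (x : Fin m → Euc n) (z : Euc n) : 0 ≤ Usum x z :=
  Finset.sum_nonneg fun i _ => abs_nonneg _

lemma Usum_upper {n m : ℕ} (x : Fin m → Euc n) (N : Finset (Euc n)) (A : ℝ)
    (hN : ∀ z : Euc n, ‖z‖ = 1 → ∃ w ∈ N, ‖z - w‖ < 1 / 2) (hA : ∀ w ∈ N, Usum x w ≤ A) :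
    ∀ z : Euc n, Usum x z ≤ 2 * A * ‖z‖ := by
  have hsc : ∀ K : ℝ, (∀ z : Euc n, ‖z‖ = 1 → Usum x z ≤ K) → ∀ z : Euc n, Usum x z ≤ K * ‖z‖ := by
    intro K hK z
    rcases eq_or_ne z 0 with rfl | hz
    · simp [Usum]
    · have hz' : ‖z‖ ≠ 0 := norm_ne_zero_iff.2 hz
      have h1 := hK (‖z‖⁻¹ • z) (by rw [norm_smul, norm_inv, norm_norm, inv_mul_cancel₀ hz'])
      rw [Usum_smul, abs_inv, abs_norm, inv_mul_le_iff₀ (by positivity)] at h1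
      linarith
  apply hsc
  intro z hz
  have hcont : Continuous (Usum x) := by unfold Usum; fun_prop
  obtain ⟨z0, hz0, hmax⟩ := (isCompact_sphere (0 : Euc n) 1).exists_isMaxOn ⟨z, by simpa using hz⟩ hcont.continuousOn
  have hb : ∀ v : Euc n, ‖v‖ = 1 → Usum x v ≤ Usum x z0 := fun v hv => hmax (by simpa using hv)
  have hb' := hsc _ hb
  obtain ⟨w, hw, hzw⟩ := hN z0 (by simpa using hz0)
  have h2 := Usum_add x w (z0 - w)
  rw [add_sub_cancel] at h2
  have h3 := hb' (z0 - w)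
  have h4 := hA w hw
  have h5 := hb z hz
  have h6 := Usum_nonneg x z0
  nlinarith

lemma Usum_lower {n m : ℕ} (x : Fin m → Euc n) (N : Finset (Euc n)) (A B ε : ℝ) (hA : 0 ≤ A)
    (hN : ∀ z : Euc n, ‖z‖ = 1 → ∃ w ∈ N, ‖z - w‖ < ε) (hU : ∀ z : Euc n, Usum x z ≤ A * ‖z‖)
    (hB : ∀ w ∈ N, B ≤ Usum x w) :
    ∀ z : Euc n, (B - A * ε) * ‖z‖ ≤ Usum x z := by
  intro z
  rcases eq_or_ne z 0 with rfl | hz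
  · simp [Usum]
  have hz' : ‖z‖ ≠ 0 := norm_ne_zero_iff.2 hz
  have key : ∀ z : Euc n, ‖z‖ = 1 → B - A * ε ≤ Usum x z := by
    intro z hz
    obtain ⟨w, hw, hzw⟩ := hN z hz
    have h2 := Usum_add x z (w - z)
    rw [add_sub_cancel] at h2
    have h3 := hU (w - z)
    have h4 := hB w hw
    rw [norm_sub_rev] at h3
    nlinarith
  have h1 := key (‖z‖⁻¹ • z) (by rw [norm_smul, norm_inv, norm_norm, inv_mul_cancel₀ hz'])
  rw [Usum_smul, abs_inv, abs_norm, le_inv_mul_iff₀ (by positivity)] at h1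
  linarith

lemma union_bound {Ω α : Type*} [MeasurableSpace Ω] (P : Measure Ω) (N : Finset α) (S : α → Set Ω)
    (K a b : ℝ) (n : ℕ) (hN : (N.card : ℝ) ≤ K ^ n) (hK : 0 < K) (hab : Real.log K * n ≤ a - b) 
    (hS : ∀ w ∈ N, P (S w) ≤ ENNReal.ofReal (Real.exp (-a))) :
    P (⋃ w ∈ N, S w) ≤ ENNReal.ofReal (Real.exp (-b)) := by
  calc P (⋃ w ∈ N, S w) ≤ ∑ w ∈ N, P (S w) := measure_biUnion_finset_le _ _
    _ ≤ ∑ w ∈ N, ENNReal.ofReal (Real.exp (-a)) := Finset.sum_le_sum hS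
    _ = ENNReal.ofReal (N.card * Real.exp (-a)) := by
      rw [Finset.sum_const, nsmul_eq_mul, ENNReal.ofReal_mul (by positivity), ENNReal.ofReal_natCast]
    _ ≤ _ := by
      apply ENNReal.ofReal_le_ofReal
      calc N.card * Real.exp (-a) ≤ K ^ n * Real.exp (-a) := by gcongr
        _ = Real.exp (Real.log K * n) * Real.exp (-a) := by
          rw [mul_comm (Real.log K), Real.exp_nat_mul, Real.exp_log hK]
        _ = Real.exp (Real.log K * n - a) := by rw [← Real.exp_add]; rfl
        _ ≤ _ := Real.exp_le_exp.2 (by linarith)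

lemma exp_neg_four : Real.exp (-4) ≤ 1 / 16 := by
  have h : Real.exp (-4) = (Real.exp (-1)) ^ 4 := by
    rw [← Real.exp_nat_mul]; norm_num
  have h2 : Real.exp (-1) ≤ 1 / 2 := by
    rw [Real.exp_neg, inv_le_comm₀ (Real.exp_pos _) (by norm_num)]
    have := Real.add_one_le_exp (1:ℝ)
    norm_num at this ⊢; exact this
  rw [h]
  calc _ ≤ (1/2 : ℝ)^4 := by gcongr
    _ = _ := by norm_num

lemma L1_event : ∃ C₀ c : ℝ, 1 ≤ C₀ ∧ 0 < c ∧ ∀ (n : ℕ), 1 ≤ n → ∀ (μ : Measure (Euc n)), IsIsotropicLogConcave n μ →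
    ∀ m : ℕ, C₀ * n ≤ m → 
    (Measure.pi fun _ : Fin m => μ) {x | ¬ ∀ z : Euc n, c * m * ‖z‖ ≤ Usum x z} ≤ ENNReal.ofReal (1 / 8) := by
  obtain ⟨M, hM, hexp⟩ := exp_moment
  obtain ⟨c, c0, c1, hc⟩ := first_moment
  set t : ℝ := 40 * (Real.log M + Real.log 5 + 4) with ht
  have hlM : 0 ≤ Real.log M := Real.log_nonneg hM
  have hl5 : 0 ≤ Real.log 5 := Real.log_nonneg (by norm_num)
  have t0 : 0 < t := by positivity
  set ε := c / (16 * t) with hε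
  have ε0 : 0 < ε := by positivity
  set K := 1 + 2 / ε with hK
  have K1 : 1 ≤ K := by rw [hK]; have : 0 ≤ 2 / ε := by positivity
                        linarith
  have hlK : 0 ≤ Real.log K := Real.log_nonneg K1
  refine ⟨max 1 (4 / c ^ 2 * (Real.log K + 4)), c / 8, le_max_left _ _, by positivity, fun n hn μ hμ m hm => ?_⟩
  have hprob : IsProbabilityMeasure μ := by obtain ⟨f, _, _, _, hp, _⟩ := hμ; exact hp
  have n1 : (1 : ℝ) ≤ n := by exact_mod_cast hn
  have hm1 : (n : ℝ) ≤ m := by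
    refine le_trans ?_ hm
    have := le_max_left 1 (4 / c ^ 2 * (Real.log K + 4))
    nlinarith
  have hm2 : (Real.log K + 4) * n ≤ c ^ 2 / 4 * m := by
    have h1 := le_max_right 1 (4 / c ^ 2 * (Real.log K + 4))
    have h2 : 4 / c ^ 2 * (Real.log K + 4) * n ≤ m := le_trans (by gcongr) hm
    have h3 : (Real.log K + 4) * n = c ^ 2 / 4 * (4 / c ^ 2 * (Real.log K + 4) * n) := by
      field_simp
    rw [h3]; gcongr
  obtain ⟨N1, hN1, cN1, dN1⟩ := sphere_net n (1/2) (by norm_num)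
  obtain ⟨N2, hN2, cN2, dN2⟩ := sphere_net n ε ε0
  set P := Measure.pi fun _ : Fin m => μ
  have b1 : P (⋃ w ∈ N1, {x | t * m ≤ Usum x w}) ≤ ENNReal.ofReal (Real.exp (-4)) := by
    refine union_bound P N1 _ (1 + 2 / (1/2)) ((Real.log 5 + 4) * m) 4 n cN1 (by norm_num) ?_ ?_
    · norm_num
      nlinarith
    · intro w hw
      have h0 := chernoff μ m (fun x => |⟪x, w⟫| / 40) (by fun_prop) (Real.log M) (t / 40) (by
        rw [Real.exp_log (by linarith)]; exact hexp n μ hμ w (hN1 w hw))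
      refine le_trans (measure_mono ?_) (h0.trans (ENNReal.ofReal_le_ofReal (Real.exp_le_exp.2 ?_)))
      · intro x hx
        simp only [mem_setOf_eq, Usum] at hx ⊢
        rw [← Finset.sum_div]
        linarith
      · rw [ht]; apply le_of_eq; ring
  have b2 : P (⋃ w ∈ N2, {x | Usum x w ≤ c / 4 * m}) ≤ ENNReal.ofReal (Real.exp (-4)) := by
    refine union_bound P N2 _ K (c ^ 2 / 4 * m) 4 n cN2 (by linarith) ?_ ?_
    · nlinarith
    · intro w hw
      have h0 := chernoff μ m (fun x => -c * |⟪x, w⟫|) (by fun_prop) (-(c ^ 2 / 2)) (-(c ^ 2 / 4)) (hc n μ hμ w (hN2 w hw))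
      refine le_trans (measure_mono ?_) (h0.trans (ENNReal.ofReal_le_ofReal (Real.exp_le_exp.2 ?_)))
      · intro x hx
        simp only [mem_setOf_eq, Usum] at hx ⊢
        rw [← Finset.mul_sum]
        nlinarith
      · apply le_of_eq; ring
  have sub : {x | ¬ ∀ z : Euc n, c / 8 * m * ‖z‖ ≤ Usum x z} ⊆ 
      (⋃ w ∈ N1, {x : Fin m → Euc n | t * m ≤ Usum x w}) ∪ (⋃ w ∈ N2, {x | Usum x w ≤ c / 4 * m}) := by
    intro x hx
    by_contra hcon
    apply hx
    simp only [mem_union, mem_iUnion, mem_setOf_eq, not_or, not_exists, not_le] at hcon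
    have u1 := Usum_upper x N1 (t * m) dN1 (fun w hw => (hcon.1 w hw).le)
    have u2 := Usum_lower x N2 (2 * (t * m)) (c / 4 * m) ε (by positivity) dN2 u1 (fun w hw => (hcon.2 w hw).le)
    have e : c / 4 * m - 2 * (t * m) * ε = c / 8 * m := by
      rw [hε]; field_simp; ring
    rw [e] at u2
    exact u2
  calc _ ≤ _ := measure_mono sub
    _ ≤ _ := measure_union_le _ _
    _ ≤ ENNReal.ofReal (1/16) + ENNReal.ofReal (1/16) := 
      add_le_add (b1.trans (ENNReal.ofReal_le_ofReal exp_neg_four)) (b2.trans (ENNReal.ofReal_le_ofReal exp_neg_four))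
    _ = _ := by rw [← ENNReal.ofReal_add (by norm_num) (by norm_num)]; norm_num

lemma trace_event (n : ℕ) (hn : 1 ≤ n) (μ : Measure (Euc n)) (hμ : IsIsotropicLogConcave n μ)
    (m : ℕ) (hm : 1 ≤ m) : 
    (Measure.pi fun _ : Fin m => μ) {x | ¬ ∑ i, ‖x i‖ ^ 2 ≤ 4 * m * n} ≤ ENNReal.ofReal (1 / 4) := by
  have hprob : IsProbabilityMeasure μ := by obtain ⟨f, _, _, _, hp, _⟩ := hμ; exact hp
  have e1 : ∫⁻ x, ENNReal.ofReal (‖x‖ ^ 2) ∂μ = n := by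
    have h1 : ∀ x : Euc n, ENNReal.ofReal (‖x‖ ^ 2) = ∑ j, ENNReal.ofReal (⟪x, EuclideanSpace.basisFun (Fin n) ℝ j⟫ ^ 2) := by
      intro x
      rw [← ENNReal.ofReal_sum_of_nonneg (fun j _ => sq_nonneg _)]
      congr 1
      rw [← (EuclideanSpace.basisFun (Fin n) ℝ).sum_sq_norm_inner_left x]
      simp
    simp_rw [h1]
    rw [lintegral_finsetSum _ (fun j _ => by fun_prop)]
    have h2 : ∀ j : Fin n, ∫⁻ x, ENNReal.ofReal (⟪x, EuclideanSpace.basisFun (Fin n) ℝ j⟫ ^ 2) ∂μ = 1 := by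
      intro j
      obtain ⟨i2, e2⟩ := second_moment hμ (EuclideanSpace.basisFun (Fin n) ℝ j) (by simp)
      rw [← ofReal_integral_eq_lintegral_ofReal i2 (.of_forall fun x => sq_nonneg _), e2]
      simp
    rw [Finset.sum_congr rfl (fun j _ => h2 j)]; simp
  set P := Measure.pi fun _ : Fin m => μ
  have e2 : ∫⁻ x, ∑ i, ENNReal.ofReal (‖x i‖ ^ 2) ∂P = m * n := by
    rw [lintegral_finsetSum _ (fun j _ => by fun_prop)]
    have h2 : ∀ i : Fin m, ∫⁻ x, ENNReal.ofReal (‖x i‖ ^ 2) ∂P = n := fun i => by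
      rw [← e1]
      exact (measurePreserving_eval (fun _ : Fin m => μ) i).lintegral_comp (f := fun x => ENNReal.ofReal (‖x‖ ^ 2)) (by fun_prop)
    rw [Finset.sum_congr rfl (fun j _ => h2 j)]; simp
  have h3 := meas_ge_le_lintegral_div (μ := P) (f := fun x => ∑ i, ENNReal.ofReal (‖x i‖ ^ 2))
    (Measurable.aemeasurable (by fun_prop)) (ε := ENNReal.ofReal (4 * m * n)) (ENNReal.ofReal_pos.2 (by positivity)).ne' ENNReal.ofReal_ne_top
  rw [e2] at h3
  refine (measure_mono ?_).trans (h3.trans ?_)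
  · intro x hx
    simp only [mem_setOf_eq, not_le] at hx ⊢
    rw [← ENNReal.ofReal_sum_of_nonneg (fun j _ => sq_nonneg _)]
    exact ENNReal.ofReal_le_ofReal hx.le
  · have : (m : ℝ≥0∞) * n = ENNReal.ofReal (m * n) := by
      rw [ENNReal.ofReal_mul (by positivity)]; simp
    rw [this, ← ENNReal.ofReal_div_of_pos (by positivity)]
    apply ENNReal.ofReal_le_ofReal
    rw [div_le_div_iff₀ (by positivity) (by norm_num)]
    linarith

lemma good_event : ∃ C₀ c : ℝ, 1 ≤ C₀ ∧ 0 < c ∧ ∀ (n : ℕ), 1 ≤ n → ∀ (μ : Measure (Euc n)), IsIsotropicLogConcave n μ →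
    ∀ m : ℕ, C₀ * n ≤ m → ∀ S : Set (Fin m → Euc n), 
      (∀ x, (∀ z : Euc n, c * m * ‖z‖ ≤ Usum x z) → ∑ i, ‖x i‖ ^ 2 ≤ 4 * m * n → x ∈ S) → 
      1 / 2 < (Measure.pi fun _ : Fin m => μ) S := by
  obtain ⟨C₀, c, hC, hc, h⟩ := L1_event
  refine ⟨C₀, c, hC, hc, fun n hn μ hμ m hm S hS => ?_⟩
  have hprob : IsProbabilityMeasure μ := by obtain ⟨f, _, _, _, hp, _⟩ := hμ; exact hp
  have n1 : (1 : ℝ) ≤ n := by exact_mod_cast hn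
  have hm1 : 1 ≤ m := by
    have : (1:ℝ) ≤ m := by nlinarith
    exact_mod_cast this
  have h1 := h n hn μ hμ m hm
  have h2 := trace_event n hn μ hμ m hm1
  set P := Measure.pi fun _ : Fin m => μ
  have hu : (univ : Set (Fin m → Euc n)) ⊆ S ∪ ({x | ¬ ∀ z : Euc n, c * m * ‖z‖ ≤ Usum x z} ∪ {x | ¬ ∑ i, ‖x i‖ ^ 2 ≤ 4 * m * n}) := by
    intro x _
    by_cases a : ∀ z : Euc n, c * m * ‖z‖ ≤ Usum x z
    · by_cases b : ∑ i, ‖x i‖ ^ 2 ≤ 4 * m * n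
      · exact Or.inl (hS x a b)
      · exact Or.inr (Or.inr b)
    · exact Or.inr (Or.inl a)
  by_contra hcon
  rw [not_lt] at hcon
  have : (1 : ℝ≥0∞) ≤ 1 / 2 + (ENNReal.ofReal (1/8) + ENNReal.ofReal (1/4)) := by
    calc (1 : ℝ≥0∞) = P univ := measure_univ.symm
      _ ≤ _ := measure_mono hu
      _ ≤ _ := measure_union_le _ _
      _ ≤ _ := add_le_add hcon ((measure_union_le _ _).trans (add_le_add h1 h2))
  have e : (1 / 2 : ℝ≥0∞) = ENNReal.ofReal (1/2) := by
    rw [ENNReal.ofReal_div_of_pos (by norm_num)]; simp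
  rw [e, ← ENNReal.ofReal_add (by norm_num) (by norm_num), ← ENNReal.ofReal_add (by norm_num) (by norm_num)] at this
  rw [ENNReal.one_le_ofReal] at this
  norm_num at this


lemma grid_sum (m : ℕ) : ∑ j ∈ Finset.Icc (-(m : ℤ)) m, (1 / 2 : ℝ) ^ j.natAbs ≤ 4 := by
  classical
  have hsub : Finset.Icc (-(m : ℤ)) m ⊆ (Finset.range (m + 1)).image (fun k : ℕ => (k : ℤ)) ∪
      (Finset.range (m + 1)).image (fun k : ℕ => -(k : ℤ)) := by
    intro j hj
    rw [Finset.mem_Icc] at hj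
    simp only [Finset.mem_union, Finset.mem_image, Finset.mem_range]
    rcases le_total 0 j with h | h
    · left; exact ⟨j.natAbs, by omega, by omega⟩
    · right; exact ⟨j.natAbs, by omega, by omega⟩
  calc _ ≤ ∑ j ∈ (Finset.range (m + 1)).image (fun k : ℕ => (k : ℤ)) ∪
      (Finset.range (m + 1)).image (fun k : ℕ => -(k : ℤ)), (1 / 2 : ℝ) ^ j.natAbs :=
        Finset.sum_le_sum_of_subset_of_nonneg hsub (fun _ _ _ => by positivity)
    _ ≤ ∑ j ∈ (Finset.range (m + 1)).image (fun k : ℕ => (k : ℤ)), (1 / 2 : ℝ) ^ j.natAbs +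
      ∑ j ∈ (Finset.range (m + 1)).image (fun k : ℕ => -(k : ℤ)), (1 / 2 : ℝ) ^ j.natAbs := by
        rw [← Finset.sum_union_inter]
        exact le_add_of_nonneg_right (Finset.sum_nonneg fun _ _ => by positivity)
    _ = ∑ k ∈ Finset.range (m + 1), (1 / 2 : ℝ) ^ k + ∑ k ∈ Finset.range (m + 1), (1 / 2 : ℝ) ^ k := by
        rw [Finset.sum_image (fun a _ b _ h => by simpa using h), Finset.sum_image (fun a _ b _ h => by simpa using h)]
        simp
    _ ≤ 2 + 2 := add_le_add (sum_geometric_two_le _) (sum_geometric_two_le _)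
    _ = 4 := by norm_num

lemma grid_card (m : ℕ) : ∃ F : Finset (Fin m → ℤ), (F.card : ℝ) ≤ 8 ^ m ∧
    ∀ k : Fin m → ℤ, ∑ i, (k i).natAbs ≤ m → k ∈ F := by
  classical
  refine ⟨(Fintype.piFinset fun _ : Fin m => Finset.Icc (-(m : ℤ)) m).filter (fun k => ∑ i, (k i).natAbs ≤ m), ?_, ?_⟩
  · set F := (Fintype.piFinset fun _ : Fin m => Finset.Icc (-(m : ℤ)) m).filter (fun k => ∑ i, (k i).natAbs ≤ m) with hF
    have h1 : ∀ k ∈ F, (1 : ℝ) ≤ 2 ^ m * ∏ i, (1 / 2 : ℝ) ^ (k i).natAbs := by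
      intro k hk
      rw [hF, Finset.mem_filter] at hk
      rw [Finset.prod_pow_eq_pow_sum]
      calc (1 : ℝ) = 2 ^ m * (1/2) ^ m := by rw [← mul_pow]; norm_num
        _ ≤ _ := by
          gcongr 2 ^ m * ?_
          exact pow_le_pow_of_le_one (by norm_num) (by norm_num) hk.2
    calc (F.card : ℝ) = ∑ k ∈ F, 1 := by simp
      _ ≤ ∑ k ∈ F, 2 ^ m * ∏ i, (1 / 2 : ℝ) ^ (k i).natAbs := Finset.sum_le_sum h1
      _ ≤ ∑ k ∈ Fintype.piFinset fun _ : Fin m => Finset.Icc (-(m : ℤ)) m, 2 ^ m * ∏ i, (1 / 2 : ℝ) ^ (k i).natAbs :=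
        Finset.sum_le_sum_of_subset_of_nonneg (Finset.filter_subset _ _) (fun _ _ _ => by positivity)
      _ = 2 ^ m * (∑ j ∈ Finset.Icc (-(m : ℤ)) m, (1 / 2 : ℝ) ^ j.natAbs) ^ m := by
        rw [← Finset.mul_sum, ← Finset.prod_univ_sum (t := fun _ : Fin m => Finset.Icc (-(m : ℤ)) m) (f := fun _ j => (1 / 2 : ℝ) ^ j.natAbs)]
        simp
      _ ≤ 2 ^ m * 4 ^ m := by
        gcongr
        exact grid_sum m
      _ = _ := by rw [← mul_pow]; norm_num
  · intro k hk
    rw [Finset.mem_filter]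
    refine ⟨?_, hk⟩
    rw [Fintype.mem_piFinset]
    intro i
    have := Finset.single_le_sum (f := fun i => (k i).natAbs) (fun _ _ => Nat.zero_le _) (Finset.mem_univ i)
    rw [Finset.mem_Icc]
    omega

lemma absConv_sub {n m : ℕ} (x : Fin m → Euc n) : ∀ y ∈ absConv n (range x), ∃ l : Fin m → ℝ, ∑ i, |l i| ≤ 1 ∧ y = ∑ i, l i • x i := by
  classical
  let f : (Fin m → ℝ) →ₗ[ℝ] Euc n := Fintype.linearCombination ℝ x
  have hc : Convex ℝ {l : Fin m → ℝ | ∑ i, |l i| ≤ 1} := by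
    intro a ha b hb s t hs ht hst
    simp only [mem_setOf_eq] at *
    calc ∑ i, |(s • a + t • b) i| ≤ ∑ i, (s * |a i| + t * |b i|) := by
          refine Finset.sum_le_sum fun i _ => ?_
          simp only [Pi.add_apply, Pi.smul_apply, smul_eq_mul]
          refine (abs_add_le _ _).trans ?_
          rw [abs_mul, abs_mul, abs_of_nonneg hs, abs_of_nonneg ht]
      _ = s * ∑ i, |a i| + t * ∑ i, |b i| := by rw [Finset.sum_add_distrib, Finset.mul_sum, Finset.mul_sum]
      _ ≤ s * 1 + t * 1 := by gcongr
      _ = 1 := by linarith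
  have h : absConv n (range x) ⊆ f '' {l : Fin m → ℝ | ∑ i, |l i| ≤ 1} := by
    refine convexHull_min ?_ (hc.linear_image f)
    rintro y (⟨i, rfl⟩ | ⟨i, hi⟩)
    · refine ⟨Pi.single i 1, ?_, by simp [f]⟩
      simp only [mem_setOf_eq]
      rw [Finset.sum_eq_single i (fun j _ hj => by simp [hj]) (by simp)]
      simp
    · refine ⟨Pi.single i (-1), ?_, by simp [f, hi]⟩
      simp only [mem_setOf_eq]
      rw [Finset.sum_eq_single i (fun j _ hj => by simp [hj]) (by simp)]
      simp
  intro y hy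
  obtain ⟨l, hl, rfl⟩ := h hy
  exact ⟨l, hl, by simp [f, Fintype.linearCombination_apply]⟩

lemma round_int (a : ℝ) : ∃ k : ℤ, (k.natAbs : ℝ) ≤ |a| ∧ |a - k| ≤ 1 := by
  rcases le_total 0 a with h | h
  · refine ⟨⌊a⌋, ?_, ?_⟩
    · rw [Nat.cast_natAbs, Int.cast_abs, abs_of_nonneg h, abs_of_nonneg (by exact_mod_cast Int.floor_nonneg.2 h)]
      exact Int.floor_le a
    · rw [abs_le]; constructor <;> linarith [Int.floor_le a, Int.lt_floor_add_one a]
  · refine ⟨⌈a⌉, ?_, ?_⟩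
    · have h2 : ((⌈a⌉ : ℤ) : ℝ) ≤ 0 := by
        have : ⌈a⌉ ≤ 0 := Int.ceil_le.2 (by simpa using h)
        exact_mod_cast this
      rw [Nat.cast_natAbs, Int.cast_abs, abs_of_nonpos h, abs_of_nonpos h2]
      linarith [Int.le_ceil a]
    · rw [abs_le]; constructor <;> linarith [Int.le_ceil a, Int.ceil_lt_add_one a]

/-- the ellipsoid -/
lemma ellipsoid {n m : ℕ} (hm : 1 ≤ m) (x : Fin m → Euc n) (hx : ∀ z : Euc n, z ≠ 0 → 0 < Usum x z)
    (htr : ∑ i, ‖x i‖ ^ 2 ≤ 4 * m * n) :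
    ∃ E : Set (Euc n), volume E ≤ ENNReal.ofReal (2 ^ n) * volume (Metric.closedBall (0 : Euc n) 1) ∧ 
      ∀ t : Fin m → ℝ, ∑ i, t i ^ 2 ≤ 1 / m → ∑ i, t i • x i ∈ E := by
  classical
  have m0 : (0 : ℝ) < m := by exact_mod_cast hm
  let S : Euc n →ₗ[ℝ] Euc n := ∑ i, (innerₛₗ ℝ (x i)).smulRight (x i)
  have hS : ∀ y, S y = ∑ i, ⟪x i, y⟫ • x i := fun y => by simp [S, LinearMap.sum_apply]
  have hin : ∀ y z, ⟪S y, z⟫ = ∑ i, ⟪x i, y⟫ * ⟪x i, z⟫ := fun y z => by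
    rw [hS, sum_inner]; simp [inner_smul_left]
  have hsym : S.IsSymmetric := fun y z => by
    rw [hin, real_inner_comm, hin]
    exact Finset.sum_congr rfl fun i _ => mul_comm _ _
  have hfr : Module.finrank ℝ (Euc n) = n := by simp
  let v := hsym.eigenvectorBasis hfr
  let l := hsym.eigenvalues hfr
  have hv : ∀ j k, ∑ i, ⟪x i, v j⟫ * ⟪x i, v k⟫ = if j = k then l j else 0 := by
    intro j k
    rw [← hin, show S (v j) = l j • v j from hsym.apply_eigenvectorBasis hfr j, inner_smul_left]
    have := orthonormal_iff_ite.1 v.orthonormal j k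
    rw [this]; simp
  have lpos : ∀ j, 0 < l j := by
    intro j
    have h1 := hv j j
    rw [if_pos rfl] at h1
    have h0 : 0 ≤ l j := by rw [← h1]; exact Finset.sum_nonneg fun i _ => mul_self_nonneg _
    refine lt_of_le_of_ne h0 fun h2 => ?_
    rw [← h2, Finset.sum_eq_zero_iff_of_nonneg (fun i _ => mul_self_nonneg _)] at h1
    have h3 := hx (v j) (v.orthonormal.ne_zero j)
    have : Usum x (v j) = 0 := Finset.sum_eq_zero fun i hi => by
      rw [mul_self_eq_zero.1 (h1 i hi)]; simp
    linarith
  have lsum : ∑ j, l j = ∑ i, ‖x i‖ ^ 2 := by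
    have h1 : ∀ j, l j = ∑ i, ⟪x i, v j⟫ ^ 2 := fun j => by
      have := hv j j
      rw [if_pos rfl] at this
      rw [← this]; simp [pow_two]
    simp_rw [h1]
    rw [Finset.sum_comm]
    refine Finset.sum_congr rfl fun i _ => ?_
    rw [← v.sum_sq_norm_inner_left (x i)]; simp
  let D : Euc n →ₗ[ℝ] Euc n := Matrix.toLin v.toBasis v.toBasis (Matrix.diagonal fun j => Real.sqrt (l j / m))
  have hD : ∀ w : Fin n → ℝ, D (∑ j, w j • v j) = ∑ j, (Real.sqrt (l j / m) * w j) • v j := by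
    intro w
    rw [map_sum]
    refine Finset.sum_congr rfl fun j _ => ?_
    rw [map_smul]
    have : D (v j) = Real.sqrt (l j / m) • v j := by
      have h := Matrix.toLin_self v.toBasis v.toBasis (Matrix.diagonal fun j => Real.sqrt (l j / m)) j
      rw [Finset.sum_eq_single j (fun k _ hk => by rw [Matrix.diagonal_apply_ne _ hk, zero_smul]) (by simp)] at h
      simpa [D] using h
    rw [this, smul_smul, mul_comm]
  have hdet : LinearMap.det D = ∏ j, Real.sqrt (l j / m) := by
    simp only [D, LinearMap.det_toLin, Matrix.det_diagonal]
  refine ⟨D '' Metric.closedBall 0 1, ?_, ?_⟩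
  · rw [Measure.addHaar_image_linearMap]
    gcongr
    rw [hdet, abs_of_nonneg (Finset.prod_nonneg fun j _ => Real.sqrt_nonneg _)]
    have h1 : ∀ j, Real.sqrt (l j / m) = 2 * Real.sqrt (l j / (4 * m)) := fun j => by
      rw [show l j / m = 2 ^ 2 * (l j / (4 * m)) by field_simp; norm_num, Real.sqrt_mul (by norm_num), Real.sqrt_sq (by norm_num)]
    simp_rw [h1]
    rw [Finset.prod_mul_distrib]
    simp only [Finset.prod_const, Finset.card_univ, Fintype.card_fin]
    refine mul_le_of_le_one_right (by positivity) ?_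
    rw [← Real.sqrt_prod _ (fun j _ => by have := lpos j; positivity)]
    rw [Real.sqrt_le_one]
    calc ∏ j, l j / (4 * m) ≤ ∏ j, Real.exp (l j / (4 * m) - 1) := by
          refine Finset.prod_le_prod (fun j _ => by have := lpos j; positivity) fun j _ => ?_
          have := Real.add_one_le_exp (l j / (4 * m) - 1)
          linarith
      _ = Real.exp ((∑ j, l j) / (4 * m) - n) := by
        rw [← Real.exp_sum, Finset.sum_sub_distrib, Finset.sum_div]; simp
      _ ≤ 1 := by
        rw [Real.exp_le_one_iff, lsum, sub_nonpos, div_le_iff₀ (by positivity)]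
        linarith
  · intro t ht
    let u : Fin n → EuclideanSpace ℝ (Fin m) := fun j => WithLp.toLp 2 fun i => ⟪x i, v j⟫ / Real.sqrt (l j)
    let T : EuclideanSpace ℝ (Fin m) := WithLp.toLp 2 t
    have hu : Orthonormal ℝ u := by
      rw [orthonormal_iff_ite]
      intro j k
      have h1 : ⟪u j, u k⟫ = (∑ i, ⟪x i, v j⟫ * ⟪x i, v k⟫) / (Real.sqrt (l j) * Real.sqrt (l k)) := by
        rw [PiLp.inner_apply, Finset.sum_div]
        refine Finset.sum_congr rfl fun i _ => ?_
        simp only [u, RCLike.inner_apply, conj_trivial]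
        ring
      rw [h1, hv]
      split_ifs with h
      · subst h
        rw [Real.mul_self_sqrt (lpos j).le, div_self (lpos j).ne']
      · simp
    have hb := hu.sum_inner_products_le T (s := Finset.univ)
    have hT : ‖T‖ ^ 2 ≤ 1 / m := by
      rw [EuclideanSpace.norm_sq_eq]
      simpa [T] using ht
    have hw : ∀ j, ⟪u j, T⟫ = ⟪v j, ∑ i, t i • x i⟫ / Real.sqrt (l j) := by
      intro j
      rw [PiLp.inner_apply, inner_sum, Finset.sum_div]
      refine Finset.sum_congr rfl fun i _ => ?_
      simp only [u, T, RCLike.inner_apply, conj_trivial, inner_smul_right, real_inner_comm (x i) (v j)]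
      ring
    refine ⟨∑ j, (Real.sqrt m * ⟪u j, T⟫) • v j, ?_, ?_⟩
    · rw [mem_closedBall_zero_iff]
      have h3 : ‖∑ j, (Real.sqrt m * ⟪u j, T⟫) • v j‖ ^ 2 = ∑ j, (Real.sqrt m * ⟪u j, T⟫) ^ 2 := by
        rw [← real_inner_self_eq_norm_sq, v.orthonormal.inner_sum]
        simp [pow_two]
      have h4 : ∑ j, (Real.sqrt m * ⟪u j, T⟫) ^ 2 ≤ 1 := by
        simp_rw [mul_pow, Real.sq_sqrt m0.le]
        rw [← Finset.mul_sum]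
        have h5 : ∑ j, ⟪u j, T⟫ ^ 2 ≤ 1 / m := by
          refine le_trans (le_of_eq ?_) (hb.trans hT)
          simp
        calc (m : ℝ) * ∑ j, ⟪u j, T⟫ ^ 2 ≤ m * (1 / m) := by gcongr
          _ = 1 := by field_simp
      rw [← h3] at h4
      have := norm_nonneg (∑ j, (Real.sqrt m * ⟪u j, T⟫) • v j)
      nlinarith
    · rw [hD]
      conv_rhs => rw [← v.sum_repr' (∑ i, t i • x i)]
      refine Finset.sum_congr rfl fun j _ => ?_
      rw [hw]
      congr 1
      rw [Real.sqrt_div (lpos j).le]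
      have h6 : Real.sqrt (l j) ≠ 0 := (Real.sqrt_pos.2 (lpos j)).ne'
      have h7 : Real.sqrt m ≠ 0 := (Real.sqrt_pos.2 m0).ne'
      field_simp

lemma vol_absConv {n m : ℕ} (hm : 1 ≤ m) (x : Fin m → Euc n) (hx : ∀ z : Euc n, z ≠ 0 → 0 < Usum x z)
    (htr : ∑ i, ‖x i‖ ^ 2 ≤ 4 * m * n) :
    volume (absConv n (range x)) ≤ ENNReal.ofReal (8 ^ m * 2 ^ n) * volume (Metric.closedBall (0 : Euc n) 1) := by
  classical
  have m0 : (0 : ℝ) < m := by exact_mod_cast hm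
  obtain ⟨E, hE, hE2⟩ := ellipsoid hm x hx htr
  obtain ⟨F, hF, hF2⟩ := grid_card m
  have hsub : absConv n (range x) ⊆ ⋃ k ∈ F, (fun y => (∑ i, ((k i : ℝ) / m) • x i) + y) '' E := by
    intro y hy
    obtain ⟨l, hl, rfl⟩ := absConv_sub x y hy
    choose k hk1 hk2 using fun i => round_int (m * l i)
    simp only [mem_iUnion]
    refine ⟨k, hF2 k ?_, ∑ i, (l i - k i / m) • x i, hE2 _ ?_, ?_⟩
    · have : ((∑ i, (k i).natAbs : ℕ) : ℝ) ≤ m := by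
        push_cast
        calc ∑ i, ((k i).natAbs : ℝ) ≤ ∑ i, |m * l i| := Finset.sum_le_sum fun i _ => hk1 i
          _ = m * ∑ i, |l i| := by simp [abs_mul, Finset.mul_sum]
          _ ≤ m * 1 := by gcongr
          _ = m := mul_one _
      exact_mod_cast this
    · calc ∑ i, (l i - k i / m) ^ 2 ≤ ∑ i : Fin m, (1 / m : ℝ) ^ 2 := by
            refine Finset.sum_le_sum fun i _ => ?_
            have h1 : l i - k i / m = (m * l i - k i) * (1 / m) := by field_simp
            rw [h1, mul_pow]
            refine mul_le_of_le_one_left (by positivity) ?_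
            rw [← sq_abs]
            have := hk2 i
            have := abs_nonneg (m * l i - k i)
            nlinarith
        _ = 1 / m := by simp; field_simp
    · simp only
      rw [← Finset.sum_add_distrib]
      refine Finset.sum_congr rfl fun i _ => ?_
      rw [← add_smul]; congr 1; ring
  calc _ ≤ _ := measure_mono hsub
    _ ≤ ∑ k ∈ F, volume ((fun y => (∑ i, ((k i : ℝ) / m) • x i) + y) '' E) := measure_biUnion_finset_le _ _
    _ = ∑ k ∈ F, volume E := by
      refine Finset.sum_congr rfl fun k _ => ?_
      rw [image_add_left, measure_preimage_add]
    _ = F.card * volume E := by simp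
    _ ≤ ENNReal.ofReal (8 ^ m) * (ENNReal.ofReal (2 ^ n) * volume (Metric.closedBall (0 : Euc n) 1)) := by
      gcongr
      rw [← ENNReal.ofReal_natCast]
      exact ENNReal.ofReal_le_ofReal hF
    _ = _ := by rw [← mul_assoc, ← ENNReal.ofReal_mul (by positivity)]

lemma vol_ball (n : ℕ) (hn : 1 ≤ n) : volume (Metric.closedBall (0 : Euc n) 1) ≤ 
    ENNReal.ofReal ((Real.exp 1 * Real.sqrt Real.pi / Real.sqrt n) ^ n) := by
  have n0 : (0 : ℝ) < n := by exact_mod_cast hn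
  have h1 := GaussianFourier.integral_rexp_neg_mul_sq_norm (V := Euc n) (b := n) n0
  have hi : Integrable (fun v : Euc n => Real.exp (-n * ‖v‖ ^ 2)) volume := by
    by_contra hcon
    rw [integral_undef hcon] at h1
    have : 0 < (Real.pi / n) ^ ((Module.finrank ℝ (Euc n) : ℝ) / 2) := by positivity
    linarith
  have h2 : ∫ v in Metric.closedBall (0 : Euc n) 1, Real.exp (-n) ≤ ∫ v : Euc n, Real.exp (-n * ‖v‖ ^ 2) := by
    refine le_trans ?_ (setIntegral_le_integral (s := Metric.closedBall (0 : Euc n) 1) hi (.of_forall fun v => (Real.exp_pos _).le))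
    refine setIntegral_mono_on (by simp [measure_closedBall_lt_top]) hi.integrableOn measurableSet_closedBall fun v hv => ?_
    rw [mem_closedBall_zero_iff] at hv
    apply Real.exp_le_exp.2
    have : ‖v‖ ^ 2 ≤ 1 := by have := norm_nonneg v; nlinarith
    nlinarith
  rw [setIntegral_const, h1, smul_eq_mul, finrank_euclideanSpace_fin] at h2
  have h3 : volume (Metric.closedBall (0 : Euc n) 1) = ENNReal.ofReal (volume.real (Metric.closedBall (0 : Euc n) 1)) := by
    rw [Measure.real, ENNReal.ofReal_toReal measure_closedBall_lt_top.ne]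
  rw [h3]
  apply ENNReal.ofReal_le_ofReal
  have h4 : (Real.pi / n) ^ ((n : ℝ) / 2) = (Real.sqrt Real.pi / Real.sqrt n) ^ n := by
    rw [← Real.sqrt_div Real.pi_pos.le, Real.sqrt_eq_rpow, ← Real.rpow_natCast, ← Real.rpow_mul (by positivity)]
    congr 1; ring
  rw [h4, Real.exp_neg, ← div_eq_mul_inv, div_le_iff₀ (Real.exp_pos _)] at h2
  refine h2.trans (le_of_eq ?_)
  rw [mul_div_assoc, mul_pow, ← Real.exp_nat_mul, mul_one, mul_comm]


lemma ball_sub_absConv {n m : ℕ} (hm : 1 ≤ m) (x : Fin m → Euc n) (c : ℝ) (hc : 0 < c)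
    (hx : ∀ z : Euc n, c * m * ‖z‖ ≤ Usum x z) : Metric.closedBall 0 c ⊆ absConv n (range x) := by
  intro y hy
  by_contra hcon
  have hcl : IsClosed (absConv n (range x)) :=
    (((finite_range x).union (finite_range x).neg).isCompact_convexHull ℝ).isClosed
  obtain ⟨f, u, hfu, huy⟩ := geometric_hahn_banach_closed_point (convex_convexHull ℝ _) hcl hcon
  set a := (InnerProductSpace.toDual ℝ (Euc n)).symm f with ha
  have hfa : ∀ z, f z = ⟪z, a⟫ := fun z => by
    rw [real_inner_comm, ha, InnerProductSpace.toDual_symm_apply]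
  have h1 : ∀ i, |⟪x i, a⟫| ≤ u := by
    intro i
    rw [abs_le]
    have h2 := hfu (x i) (subset_convexHull ℝ _ (Or.inl ⟨i, rfl⟩))
    have h3 := hfu (-(x i)) (subset_convexHull ℝ _ (Or.inr (by simp)))
    rw [hfa] at h2 h3
    rw [inner_neg_left] at h3
    constructor <;> linarith
  have h2 : Usum x a ≤ m * u := by
    calc Usum x a ≤ ∑ i : Fin m, u := Finset.sum_le_sum fun i _ => h1 i
      _ = m * u := by simp
  have h3 := hx a
  rw [hfa] at huy
  have h4 := real_inner_le_norm y a
  rw [mem_closedBall_zero_iff] at hy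
  have m0 : (0 : ℝ) < m := by exact_mod_cast hm
  have h5 : m * (c * ‖a‖) ≤ m * u := by linarith
  have h6 := le_of_mul_le_mul_left h5 m0
  have h7 := norm_nonneg a
  nlinarith

lemma absConv_body {n m : ℕ} (hm : 1 ≤ m) (x : Fin m → Euc n) (c : ℝ) (hc : 0 < c)
    (hx : ∀ z : Euc n, c * m * ‖z‖ ≤ Usum x z) : IsSymmConvexBody n (absConv n (range x)) := by
  refine ⟨convex_convexHull ℝ _, ?_, ((finite_range x).union (finite_range x).neg).isCompact_convexHull ℝ, ?_⟩
  · unfold absConv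
    rw [← convexHull_neg]
    congr 1
    rw [Set.union_neg, neg_neg, union_comm]
  · rw [mem_interior_iff_mem_nhds]
    exact Filter.mem_of_superset (Metric.closedBall_mem_nhds 0 hc) (ball_sub_absConv hm x c hc hx)

lemma body_nhds {n : ℕ} {K : Set (Euc n)} (hK : IsSymmConvexBody n K) : K ∈ nhds (0 : Euc n) :=
  mem_interior_iff_mem_nhds.1 hK.2.2.2

lemma body_mem {n : ℕ} {K : Set (Euc n)} (hK : IsSymmConvexBody n K) {y : Euc n} (h : gauge K y ≤ 1) : y ∈ K := by
  have := (gauge_le_one_iff_mem_closure hK.1 (body_nhds hK)).1 h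
  rwa [hK.2.2.1.isClosed.closure_eq] at this

lemma opNorm_nonneg {n : ℕ} (K L : Set (Euc n)) (T : Euc n →ₗ[ℝ] Euc n) : 0 ≤ bodyOpNorm n K L T := by
  refine Real.sSup_nonneg ?_
  rintro _ ⟨x, _, rfl⟩
  exact gauge_nonneg _

lemma gauge_le_op {n : ℕ} {K L : Set (Euc n)} (hK : IsSymmConvexBody n K) (hL : IsSymmConvexBody n L)
    (T : Euc n →ₗ[ℝ] Euc n) (u : Euc n) : gauge L (T u) ≤ bodyOpNorm n K L T * gauge K u := by
  have hT : Continuous T := T.continuous_of_finiteDimensional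
  have hb : BddAbove ((fun x => gauge L (T x)) '' K) :=
    hK.2.2.1.bddAbove_image ((continuous_gauge hL.1 (body_nhds hL)).comp hT).continuousOn
  have key : ∀ r, gauge K u < r → gauge L (T u) ≤ bodyOpNorm n K L T * r := by
    intro r hr
    have r0 : 0 < r := (gauge_nonneg u).trans_lt hr
    have h1 : r⁻¹ • u ∈ K := by
      apply body_mem hK
      rw [gauge_smul_of_nonneg (by positivity), smul_eq_mul, inv_mul_le_iff₀ r0]
      linarith
    have h2 : gauge L (T (r⁻¹ • u)) ≤ bodyOpNorm n K L T := le_csSup hb ⟨_, h1, rfl⟩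
    rw [map_smul, gauge_smul_of_nonneg (by positivity), smul_eq_mul, inv_mul_le_iff₀ r0] at h2
    linarith
  refine le_of_forall_pos_le_add fun ε hε => ?_
  have hp := opNorm_nonneg K L T
  have h3 := key (gauge K u + ε / (bodyOpNorm n K L T + 1)) (lt_add_of_pos_right _ (by positivity))
  have h4 : bodyOpNorm n K L T * (ε / (bodyOpNorm n K L T + 1)) ≤ ε := by
    rw [mul_div_assoc', div_le_iff₀ (by positivity)]
    nlinarith
  rw [mul_add] at h3
  linarith

lemma box_sub {n m : ℕ} (hm : 1 ≤ m) (x : Fin m → Euc n) (L : Set (Euc n))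
    (hB : IsSymmConvexBody n (absConv n (range x))) (hL : IsSymmConvexBody n L)
    (b : Module.Basis (Fin n) ℝ (Euc n))
    (hb : ∀ lam : Fin n → ℝ, gauge L (∑ i, lam i • b i) = gauge L (∑ i, |lam i| • b i))
    (T : Euc n ≃ₗ[ℝ] Euc n) (w : Euc n)
    (hw : ∀ j, |b.repr (T w) j| ≤ (1 / m : ℝ) * ∑ i, |b.repr (T (x i)) j|) :
    gauge (absConv n (range x)) w ≤ bodyOpNorm n (absConv n (range x)) L T.toLinearMap *
      bodyOpNorm n L (absConv n (range x)) T.symm.toLinearMap := by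
  set B := absConv n (range x) with hBdef
  set p := bodyOpNorm n B L T.toLinearMap with hp
  set q := bodyOpNorm n L B T.symm.toLinearMap with hq
  have q0 : 0 ≤ q := opNorm_nonneg _ _ _
  have m0 : (0 : ℝ) < m := by exact_mod_cast hm
  have p0 : 0 ≤ p := opNorm_nonneg _ _ _
  have h1 := gauge_le_op hL hB T.symm.toLinearMap (T w)
  simp only [LinearEquiv.coe_coe, LinearEquiv.symm_apply_apply] at h1
  suffices h2 : gauge L (T w) ≤ p by
    calc _ ≤ _ := h1
      _ ≤ q * p := by gcongr
      _ = _ := mul_comm _ _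
  set ρ : Fin n → ℝ := fun j => (1 / m : ℝ) * ∑ i, |b.repr (T (x i)) j| with hρ
  have ρ0 : ∀ j, 0 ≤ ρ j := fun j => by simp only [hρ]; positivity
  have hxi : ∀ i, gauge L (∑ j, |b.repr (T (x i)) j| • b j) ≤ p := by
    intro i
    rw [← hb, b.sum_repr]
    have h3 := gauge_le_op hB hL T.toLinearMap (x i)
    have h4 : gauge B (x i) ≤ 1 := gauge_le_one_of_mem (subset_convexHull ℝ _ (Or.inl ⟨i, rfl⟩))
    calc _ ≤ _ := h3
      _ ≤ p * 1 := by gcongr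
      _ = p := mul_one _
  have hconvL : ConvexOn ℝ univ (gauge L) := by
    refine ⟨convex_univ, fun a _ b _ s t hs ht hst => ?_⟩
    refine (gauge_add_le hL.1 (absorbent_nhds_zero (body_nhds hL)) _ _).trans ?_
    rw [gauge_smul_of_nonneg hs, gauge_smul_of_nonneg ht]
  have hρp : gauge L (∑ j, ρ j • b j) ≤ p := by
    have e : ∑ j, ρ j • b j = ∑ i : Fin m, (1 / m : ℝ) • ∑ j, |b.repr (T (x i)) j| • b j := by
      rw [← Finset.smul_sum, Finset.sum_comm, Finset.smul_sum]
      refine Finset.sum_congr rfl fun j _ => ?_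
      rw [← Finset.sum_smul, smul_smul]
    rw [e]
    refine (hconvL.map_sum_le (fun i _ => by positivity) (by simp; field_simp) (fun i _ => mem_univ _)).trans ?_
    calc _ ≤ ∑ i : Fin m, (1 / m : ℝ) • p := Finset.sum_le_sum fun i _ => by
            rw [smul_eq_mul, smul_eq_mul]; gcongr; exact hxi i
      _ = p := by simp; field_simp
  have hbox : univ.pi (fun j => Icc (-ρ j) (ρ j)) ⊆ {l : Fin n → ℝ | gauge L (∑ j, l j • b j) ≤ p} := by
    have e : univ.pi (fun j => Icc (-ρ j) (ρ j)) = convexHull ℝ (univ.pi (fun j => ({-ρ j, ρ j} : Set ℝ))) := by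
      rw [convexHull_pi]
      congr 1
      ext1 j
      rw [convexHull_pair, segment_eq_Icc]
      linarith [ρ0 j]
    rw [e]
    refine convexHull_min ?_ ?_
    · intro l hl
      have : ∀ j, |l j| = ρ j := fun j => by
        rcases hl j (mem_univ j) with h | h
        · rw [h, abs_neg, abs_of_nonneg (ρ0 j)]
        · rw [mem_singleton_iff.1 h, abs_of_nonneg (ρ0 j)]
      simp only [mem_setOf_eq]
      rw [hb]
      simp_rw [this]
      exact hρp
    · have := (hconvL.comp_linearMap (Fintype.linearCombination ℝ b)).convex_le p
      simpa [Fintype.linearCombination_apply] using this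
  have := hbox (show (fun j => b.repr (T w) j) ∈ _ from fun j _ => by
    have := hw j
    rw [abs_le] at this
    exact this)
  simp only [mem_setOf_eq, b.sum_repr] at this
  exact this

lemma hadamard {n : ℕ} (a : Fin n → Euc n) :
    |(Matrix.of fun j i => a j i).det| ≤ ∏ j, ‖a j‖ := by
  haveI : Fact (Module.finrank ℝ (Euc n) = n) := ⟨by simp⟩
  let e := EuclideanSpace.basisFun (Fin n) ℝ
  rcases Nat.eq_zero_or_pos n with rfl | hn
  · simp
  have h := (e.toBasis.orientation).abs_volumeForm_apply_le a
  rw [Orientation.volumeForm_robust _ e rfl, Module.Basis.det_apply, ← Matrix.det_transpose] at h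
  convert h using 3
  ext j i
  simp [e, Module.Basis.toMatrix_apply]

lemma vol_box {n : ℕ} (ρ : Fin n → ℝ) (hρ : ∀ j, 0 ≤ ρ j) :
    volume {y : Euc n | ∀ j, |y j| ≤ ρ j} = ENNReal.ofReal (∏ j, 2 * ρ j) := by
  have h := (EuclideanSpace.volume_preserving_symm_measurableEquiv_toLp (Fin n)).measure_preimage_equiv
    (univ.pi fun j => Icc (-ρ j) (ρ j))
  rw [volume_pi_pi] at h
  have e : {y : Euc n | ∀ j, |y j| ≤ ρ j} = ((MeasurableEquiv.toLp 2 (Fin n → ℝ)).symm) ⁻¹' (univ.pi fun j => Icc (-ρ j) (ρ j)) := by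
    ext y
    simp only [abs_le, mem_setOf_eq, mem_preimage, mem_pi, mem_univ, true_imp_iff, mem_Icc]
    rfl
  rw [e, h, ENNReal.ofReal_prod_of_nonneg (fun j _ => by have := hρ j; positivity)]
  refine Finset.prod_congr rfl fun j _ => ?_
  rw [Real.volume_Icc]; congr 1; ring

lemma vol_slab {n : ℕ} (b : Module.Basis (Fin n) ℝ (Euc n)) (T : Euc n ≃ₗ[ℝ] Euc n) (c : ℝ) (hc : 0 < c)
    (ρ : Fin n → ℝ) (a : Fin n → Euc n) (ha : ∀ j w, b.repr (T w) j = ⟪w, a j⟫) (hρ : ∀ j, c * ‖a j‖ ≤ ρ j) :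
    ENNReal.ofReal ((2 * c) ^ n) ≤ volume {w : Euc n | ∀ j, |b.repr (T w) j| ≤ ρ j} := by
  have ρ0 : ∀ j, 0 ≤ ρ j := fun j => le_trans (by positivity) (hρ j)
  let e := EuclideanSpace.basisFun (Fin n) ℝ
  let M : Matrix (Fin n) (Fin n) ℝ := Matrix.of fun j i => a j i
  let A : Euc n →ₗ[ℝ] Euc n := Matrix.toLin e.toBasis e.toBasis M
  have hA : ∀ w j, A w j = b.repr (T w) j := by
    intro w j
    rw [ha]
    have h1 : e.toBasis.repr (A w) = M.mulVec (e.toBasis.repr w) := Matrix.repr_toLin _ _ _ _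
    have h2 := congrFun h1 j
    have h3 : e.toBasis.repr (A w) j = A w j := by simp [e]
    rw [h3] at h2
    rw [h2, PiLp.inner_apply]
    simp only [Matrix.mulVec, dotProduct, M, Matrix.of_apply, RCLike.inner_apply, conj_trivial]
    refine Finset.sum_congr rfl fun i _ => ?_
    congr 1
  have hdetA : LinearMap.det A = M.det := by simp only [A, LinearMap.det_toLin]
  have hinj : LinearMap.det A ≠ 0 := by
    intro h
    have h1 := LinearMap.bot_lt_ker_of_det_eq_zero h
    obtain ⟨w, hw, hw0⟩ := (Submodule.ne_bot_iff _).1 h1.ne'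
    apply hw0
    rw [LinearMap.mem_ker] at hw
    have h2 : b.repr (T w) = 0 := by
      ext j
      rw [← hA, hw]; rfl
    simpa using h2
  have hE : {w : Euc n | ∀ j, |b.repr (T w) j| ≤ ρ j} = A ⁻¹' {y : Euc n | ∀ j, |y j| ≤ ρ j} := by
    ext w
    simp [hA]
  rw [hE, Measure.addHaar_preimage_linearMap _ hinj, vol_box ρ ρ0, ← ENNReal.ofReal_mul (by positivity)]
  apply ENNReal.ofReal_le_ofReal
  have hH := hadamard a
  rw [hdetA] at hinj
  rw [hdetA, abs_inv]
  have hpos : 0 < |M.det| := abs_pos.2 hinj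
  rw [inv_mul_eq_div, le_div_iff₀ hpos]
  calc (2 * c) ^ n * |M.det| ≤ (2 * c) ^ n * ∏ j, ‖a j‖ := by gcongr
    _ = ∏ j, 2 * (c * ‖a j‖) := by
      have e1 : (2 * c) ^ n = ∏ _j : Fin n, (2 * c) := by simp
      rw [e1, ← Finset.prod_mul_distrib]
      exact Finset.prod_congr rfl fun j _ => by ring
    _ ≤ _ := by
      refine Finset.prod_le_prod (fun j _ => by positivity) fun j _ => ?_
      have := hρ j
      linarith

lemma lower_one {n m : ℕ} (hn : 1 ≤ n) (hm : 1 ≤ m) (x : Fin m → Euc n) (c : ℝ) (hc : 0 < c)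
    (hx : ∀ z : Euc n, c * m * ‖z‖ ≤ Usum x z) (htr : ∑ i, ‖x i‖ ^ 2 ≤ 4 * m * n)
    (C : ℝ) (hC : (m : ℝ) ≤ 2 * C * n)
    (L : Set (Euc n)) (hL : IsSymmConvexBody n L) (hU : HasOneUncondBasis n L) (T : Euc n ≃ₗ[ℝ] Euc n) :
    c / ((8 : ℝ) ^ (2 * C) * (Real.exp 1 * Real.sqrt Real.pi)) * Real.sqrt n ≤ bodyOpNorm n (absConv n (range x)) L T.toLinearMap *
      bodyOpNorm n L (absConv n (range x)) T.symm.toLinearMap := by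
  obtain ⟨b, hb⟩ := hU
  have hB := absConv_body hm x c hc hx
  have m0 : (0 : ℝ) < m := by exact_mod_cast hm
  have n0 : (0 : ℝ) < n := by exact_mod_cast hn
  set B := absConv n (range x) with hBdef
  set d := bodyOpNorm n B L T.toLinearMap * bodyOpNorm n L B T.symm.toLinearMap with hd
  have d0 : 0 ≤ d := mul_nonneg (opNorm_nonneg _ _ _) (opNorm_nonneg _ _ _)
  refine le_of_forall_gt_imp_ge_of_dense fun d' hd' => ?_
  have d'0 : 0 < d' := d0.trans_lt hd'
  let a : Fin n → Euc n := fun j => (InnerProductSpace.toDual ℝ (Euc n)).symm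
    (LinearMap.toContinuousLinearMap ((b.coord j).comp T.toLinearMap))
  have ha : ∀ j w, b.repr (T w) j = ⟪w, a j⟫ := fun j w => by
    rw [real_inner_comm, InnerProductSpace.toDual_symm_apply]
    simp
  have hρ : ∀ j, c * ‖a j‖ ≤ (1 / m : ℝ) * ∑ i, |b.repr (T (x i)) j| := by
    intro j
    have h1 := hx (a j)
    unfold Usum at h1
    simp_rw [← ha] at h1
    rw [one_div, le_inv_mul_iff₀ m0]
    linarith
  have h1 := vol_slab b T c hc _ a ha hρ
  have h2 : {w : Euc n | ∀ j, |b.repr (T w) j| ≤ (1 / m : ℝ) * ∑ i, |b.repr (T (x i)) j|} ⊆ d' • B := by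
    intro w hw
    have h3 := box_sub hm x L hB hL b hb T w hw
    rw [mem_smul_set_iff_inv_smul_mem₀ d'0.ne']
    apply body_mem hB
    rw [gauge_smul_of_nonneg (by positivity), smul_eq_mul, inv_mul_le_iff₀ d'0]
    linarith
  have hx' : ∀ z : Euc n, z ≠ 0 → 0 < Usum x z := fun z hz => by
    refine lt_of_lt_of_le ?_ (hx z)
    have := norm_pos_iff.2 hz
    positivity
  have h4 := vol_absConv hm x hx' htr
  have h5 := vol_ball n hn
  have h6 : ENNReal.ofReal ((2 * c) ^ n) ≤ ENNReal.ofReal (d' ^ n * (8 ^ m * 2 ^ n * (Real.exp 1 * Real.sqrt Real.pi / Real.sqrt n) ^ n)) := by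
    calc _ ≤ _ := h1
      _ ≤ volume (d' • B) := measure_mono h2
      _ = ENNReal.ofReal (d' ^ n) * volume B := by
        rw [Measure.addHaar_smul, finrank_euclideanSpace_fin, abs_of_nonneg (by positivity)]
      _ ≤ ENNReal.ofReal (d' ^ n) * (ENNReal.ofReal (8 ^ m * 2 ^ n) * ENNReal.ofReal ((Real.exp 1 * Real.sqrt Real.pi / Real.sqrt n) ^ n)) := by
        gcongr
        exact h4.trans (by gcongr)
      _ = _ := by rw [← ENNReal.ofReal_mul (by positivity), ← ENNReal.ofReal_mul (by positivity)]
  rw [ENNReal.ofReal_le_ofReal_iff (by positivity)] at h6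
  have h7 : (8 : ℝ) ^ m ≤ ((8 : ℝ) ^ (2 * C)) ^ n := by
    rw [← Real.rpow_natCast, ← Real.rpow_natCast, ← Real.rpow_mul (by norm_num)]
    exact Real.rpow_le_rpow_of_exponent_le (by norm_num) hC
  have h8 : (2 * c) ^ n ≤ (d' * ((8 : ℝ) ^ (2 * C) * 2 * (Real.exp 1 * Real.sqrt Real.pi / Real.sqrt n))) ^ n := by
    refine h6.trans ?_
    rw [mul_pow, mul_pow, mul_pow]
    gcongr
  have h9 := le_of_pow_le_pow_left₀ (by omega) (by positivity) h8
  have hs : 0 < Real.sqrt n := Real.sqrt_pos.2 n0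
  have hpi : 0 < Real.sqrt Real.pi := Real.sqrt_pos.2 Real.pi_pos
  have h10 : 0 < (8 : ℝ) ^ (2 * C) := by positivity
  rw [div_mul_eq_mul_div, div_le_iff₀ (by positivity)]
  have h11 : d' * ((8 : ℝ) ^ (2 * C) * 2 * (Real.exp 1 * Real.sqrt Real.pi / Real.sqrt n)) = 
    2 * (d' * ((8 : ℝ) ^ (2 * C) * (Real.exp 1 * Real.sqrt Real.pi))) / Real.sqrt n := by ring
  rw [h11, le_div_iff₀ hs] at h9
  linarith


lemma stretch {n : ℕ} (hn : 1 ≤ n) (θ : Euc n) (hθ : ‖θ‖ = 1) (ρ : ℝ) (hρ0 : 0 ≤ ρ) (hρ : n * ρ ^ 2 < 1) :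
    ∃ D : Euc n →ₗ[ℝ] Euc n, 1 < |LinearMap.det D| ∧ ∀ z : Euc n, ‖z‖ ≤ 1 → |⟪θ, z⟫| ≤ ρ → ‖D z‖ ≤ 1 := by
  have n1 : (1 : ℝ) ≤ n := by exact_mod_cast hn
  have hr1 : ρ ^ 2 < 1 := by nlinarith [sq_nonneg ρ]
  have hr2 : 0 < 1 - ρ ^ 2 := by linarith
  set κ := ρ ^ 2 / (1 - ρ ^ 2) with hκ
  have κ0 : 0 ≤ κ := by positivity
  have hκρ : κ * (1 - ρ ^ 2) = ρ ^ 2 := by rw [hκ]; field_simp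
  have hκ1 : (n - 1) * κ < 1 := by
    rw [hκ, mul_div_assoc', div_lt_one hr2]; nlinarith
  set η := 1 - (n - 1) * κ with hη
  have η0 : 0 < η := by linarith
  have η1 : η ≤ 1 := by
    have : 0 ≤ ((n:ℝ) - 1) * κ := mul_nonneg (by linarith) κ0
    linarith
  set s := η / (2 * (1 + κ)) with hs
  have s0 : 0 < s := by positivity
  have hs1 : s * (2 * (1 + κ)) = η := by rw [hs]; field_simp
  have hsκ : s * κ < 1 := by nlinarith
  have hsη : 2 * s ≤ η := by nlinarith [mul_nonneg s0.le κ0]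
  set β := Real.sqrt (1 - s * κ) with hβ
  have β0 : 0 < β := Real.sqrt_pos.2 (by linarith)
  have β2 : β ^ 2 = 1 - s * κ := Real.sq_sqrt (by linarith)
  set α := Real.sqrt (1 + s) with hα
  have α0 : 0 < α := Real.sqrt_pos.2 (by linarith)
  have α2 : α ^ 2 = 1 + s := Real.sq_sqrt (by linarith)
  let D : Euc n →ₗ[ℝ] Euc n := β • LinearMap.transvection ((innerₛₗ ℝ θ) : Euc n →ₗ[ℝ] ℝ) ((α / β - 1) • θ)
  have hD : ∀ z, D z = β • z + ((α - β) * ⟪θ, z⟫) • θ := by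
    intro z
    simp only [D, LinearMap.smul_apply, LinearMap.transvection.apply, innerₛₗ_apply_apply, smul_add, smul_smul]
    congr 2
    field_simp
  have hdet : LinearMap.det D = α * β ^ (n - 1) := by
    simp only [D, LinearMap.det_smul, finrank_euclideanSpace_fin]
    rw [LinearMap.transvection.det]
    simp only [innerₛₗ_apply_apply, inner_smul_right, real_inner_self_eq_norm_sq, hθ]
    obtain ⟨k, rfl⟩ : ∃ k, n = k + 1 := ⟨n - 1, by omega⟩
    simp only [Nat.add_sub_cancel, pow_succ]
    field_simp
    ring
  refine ⟨D, ?_, ?_⟩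
  · rw [hdet, abs_of_pos (by positivity)]
    have h1 : (1 : ℝ) < (α * β ^ (n - 1)) ^ 2 := by
      have e : (α * β ^ (n - 1)) ^ 2 = (1 + s) * (1 - s * κ) ^ (n - 1) := by
        rw [← α2, ← β2]; ring
      rw [e]
      have hb := one_add_mul_le_pow (a := -(s * κ)) (by linarith) (n - 1)
      have hc : ((n - 1 : ℕ) : ℝ) = n - 1 := by push_cast [hn]; ring
      rw [hc] at hb
      have h2 : 1 + (n - 1) * -(s * κ) = 1 - s * (1 - η) := by rw [hη]; ring
      rw [h2, ← sub_eq_add_neg] at hb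
      have h3 : (1 + s) * (1 - s * (1 - η)) ≤ (1 + s) * (1 - s * κ) ^ (n - 1) := by gcongr
      have h4 : 1 < (1 + s) * (1 - s * (1 - η)) := by
        have : (1 + s) * (1 - s * (1 - η)) = 1 + s * (η - s * (1 - η)) := by ring
        rw [this]
        have : 0 < η - s * (1 - η) := by nlinarith
        have := mul_pos s0 this
        linarith
      linarith
    have h5 : 0 < α * β ^ (n - 1) := by positivity
    exact (one_lt_sq_iff₀ h5.le).1 h1
  · intro z hz hzθ
    have h1 : ‖D z‖ ^ 2 = β ^ 2 * ‖z‖ ^ 2 + (α ^ 2 - β ^ 2) * ⟪θ, z⟫ ^ 2 := by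
      rw [hD, norm_add_sq_real, norm_smul, norm_smul, hθ, inner_smul_left, inner_smul_right, real_inner_comm θ z]
      simp only [Real.norm_eq_abs, mul_pow, sq_abs, mul_one, conj_trivial]
      ring
    have h2 : ⟪θ, z⟫ ^ 2 ≤ ρ ^ 2 := by rw [← sq_abs]; gcongr
    have h3 : ‖z‖ ^ 2 ≤ 1 := (sq_le_one_iff₀ (norm_nonneg _)).2 hz
    have h4 : ‖D z‖ ^ 2 ≤ 1 := by
      rw [h1]
      calc _ ≤ β ^ 2 * 1 + (α ^ 2 - β ^ 2) * ρ ^ 2 := by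
            have : 0 ≤ α ^ 2 - β ^ 2 := by rw [α2, β2]; nlinarith [mul_nonneg s0.le κ0]
            gcongr
        _ = 1 - s * (κ * (1 - ρ ^ 2)) + s * ρ ^ 2 := by rw [α2, β2]; ring
        _ = 1 := by rw [hκρ]; ring
    exact (sq_le_one_iff₀ (norm_nonneg _)).1 h4

lemma john {n m : ℕ} (hn : 1 ≤ n) (hm : 1 ≤ m) (x : Fin m → Euc n) (c : ℝ) (hc : 0 < c)
    (hx : ∀ z : Euc n, c * m * ‖z‖ ≤ Usum x z) :
    ∃ T : Euc n ≃ₗ[ℝ] Euc n, (∀ i, ‖T (x i)‖ ≤ 1) ∧ ∀ y, ‖T y‖ * Real.sqrt n ≤ 1 → y ∈ absConv n (range x) := by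
  have n1 : (1 : ℝ) ≤ n := by exact_mod_cast hn
  have hball := ball_sub_absConv hm x c hc hx
  let 𝒦 : Set (Euc n →L[ℝ] Euc n) := {T | ∀ i, ‖T (x i)‖ ≤ 1}
  have hconv : ∀ T ∈ 𝒦, ∀ y ∈ absConv n (range x), ‖T y‖ ≤ 1 := by
    intro T hT y hy
    have : absConv n (range x) ⊆ (T : Euc n →ₗ[ℝ] Euc n) ⁻¹' Metric.closedBall 0 1 := by
      refine convexHull_min ?_ ((convex_closedBall _ _).linear_preimage _)
      rintro y (⟨i, rfl⟩ | ⟨i, hi⟩)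
      · simpa using hT i
      · have h1 := hT i
        rw [hi] at h1
        simpa using h1
    simpa using this hy
  have hcl : IsClosed 𝒦 := by
    have : 𝒦 = ⋂ i, {T : Euc n →L[ℝ] Euc n | ‖T (x i)‖ ≤ 1} := by ext T; simp [𝒦]
    rw [this]
    refine isClosed_iInter fun i => isClosed_le ?_ continuous_const
    exact ((ContinuousLinearMap.apply ℝ (Euc n) (x i)).continuous).norm
  have hbd : Bornology.IsBounded 𝒦 := by
    rw [isBounded_iff_forall_norm_le]
    refine ⟨1 / c, fun T hT => ?_⟩
    refine T.opNorm_le_bound (by positivity) fun y => ?_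
    rcases eq_or_ne y 0 with rfl | hy
    · simp
    have hy' : 0 < ‖y‖ := norm_pos_iff.2 hy
    have h1 := hconv T hT ((c / ‖y‖) • y) (hball (by
      rw [mem_closedBall_zero_iff, norm_smul, norm_div, norm_norm, Real.norm_of_nonneg hc.le]
      field_simp; rfl))
    rw [map_smul, norm_smul, norm_div, norm_norm, Real.norm_of_nonneg hc.le] at h1
    rw [div_mul_eq_mul_div, div_le_iff₀ hy'] at h1
    rw [div_mul_eq_mul_div, le_div_iff₀ hc]
    linarith
  haveI : ProperSpace (Euc n →L[ℝ] Euc n) := FiniteDimensional.proper ℝ _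
  have hcpt : IsCompact 𝒦 := Metric.isCompact_of_isClosed_isBounded hcl hbd
  set R : ℝ := ∑ i, ‖x i‖ + 1 with hR
  have R0 : 0 < R := by positivity
  have hI : R⁻¹ • ContinuousLinearMap.id ℝ (Euc n) ∈ 𝒦 := by
    intro i
    have h1 : ‖x i‖ ≤ ∑ i, ‖x i‖ := Finset.single_le_sum (f := fun i => ‖x i‖) (fun _ _ => norm_nonneg _) (Finset.mem_univ i)
    simp only [ContinuousLinearMap.smul_apply, ContinuousLinearMap.id_apply, norm_smul, norm_inv, Real.norm_of_nonneg R0.le]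
    rw [inv_mul_le_iff₀ R0]; linarith
  obtain ⟨T, hT, hmax⟩ := hcpt.exists_isMaxOn (f := fun T => |T.det|) ⟨_, hI⟩
    (ContinuousLinearMap.continuous_det.abs).continuousOn
  have hTpos : 0 < |T.det| := by
    refine lt_of_lt_of_le ?_ (hmax hI)
    simp only [ContinuousLinearMap.det, ContinuousLinearMap.toLinearMap_smul, ContinuousLinearMap.coe_id, LinearMap.det_smul, LinearMap.det_id]
    positivity
  have hdet : LinearMap.det (T : Euc n →ₗ[ℝ] Euc n) ≠ 0 := abs_pos.1 hTpos
  let T' : Euc n ≃ₗ[ℝ] Euc n := LinearMap.equivOfDetNeZero (T : Euc n →ₗ[ℝ] Euc n) hdet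
  have hT' : ∀ z, T' z = T z := fun z => rfl
  refine ⟨T', fun i => hT i, fun y hy => ?_⟩
  by_contra hcon
  have hB := absConv_body hm x c hc hx
  obtain ⟨f, u, hfu, huy⟩ := geometric_hahn_banach_closed_point hB.1 hB.2.2.1.isClosed hcon
  let g : Euc n →L[ℝ] ℝ := LinearMap.toContinuousLinearMap ((f : Euc n →ₗ[ℝ] ℝ).comp T'.symm.toLinearMap)
  have hg : ∀ z, g (T' z) = f z := fun z => by simp [g]
  set a := (InnerProductSpace.toDual ℝ (Euc n)).symm g with ha
  have hga : ∀ z, ⟪a, T' z⟫ = f z := fun z => by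
    rw [ha, InnerProductSpace.toDual_symm_apply, hg]
  have u0 : 0 < u := by
    have := hfu 0 (interior_subset hB.2.2.2)
    simpa using this
  have h1 : ∀ i, |⟪a, T' (x i)⟫| ≤ u := by
    intro i
    rw [hga, abs_le]
    have h2 := hfu (x i) (subset_convexHull ℝ _ (Or.inl ⟨i, rfl⟩))
    have h3 := hfu (-(x i)) (subset_convexHull ℝ _ (Or.inr (by simp)))
    rw [map_neg] at h3
    constructor <;> linarith
  have h4 : u < ‖a‖ * ‖T' y‖ := by
    rw [← hga] at huy
    exact huy.trans_le (real_inner_le_norm _ _)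
  have a0 : 0 < ‖a‖ := by
    rcases (norm_nonneg a).eq_or_lt with h | h
    · rw [← h] at h4; linarith
    · exact h
  have sn : 0 < Real.sqrt n := Real.sqrt_pos.2 (by linarith)
  have h5 : u * Real.sqrt n < ‖a‖ := by
    calc u * Real.sqrt n < ‖a‖ * ‖T' y‖ * Real.sqrt n := by gcongr
      _ = ‖a‖ * (‖T' y‖ * Real.sqrt n) := by ring
      _ ≤ ‖a‖ * 1 := by gcongr
      _ = ‖a‖ := mul_one _
  obtain ⟨D, hD1, hD2⟩ := stretch hn (‖a‖⁻¹ • a) (by rw [norm_smul, norm_inv, norm_norm, inv_mul_cancel₀ a0.ne'])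
    (u / ‖a‖) (by positivity) (by
      rw [div_pow, mul_div_assoc', div_lt_one (by positivity)]
      have : (u * Real.sqrt n) ^ 2 < ‖a‖ ^ 2 := by gcongr
      rw [mul_pow, Real.sq_sqrt (by linarith)] at this
      linarith)
  let T2 : Euc n →L[ℝ] Euc n := LinearMap.toContinuousLinearMap (D ∘ₗ (T : Euc n →ₗ[ℝ] Euc n))
  have hT2 : T2 ∈ 𝒦 := by
    intro i
    refine hD2 (T (x i)) (hT i) ?_
    rw [inner_smul_left, abs_mul, div_eq_inv_mul]
    simp only [conj_trivial, abs_inv, abs_norm]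
    have := h1 i
    rw [hT'] at this
    gcongr
  have h6 : |T2.det| ≤ |T.det| := hmax hT2
  have h7 : T2.det = LinearMap.det D * T.det := by
    simp only [T2, ContinuousLinearMap.det, LinearMap.coe_toContinuousLinearMap, LinearMap.det_comp]
  rw [h7, abs_mul] at h6
  nlinarith

lemma ball_body (n : ℕ) : IsSymmConvexBody n (Metric.closedBall (0 : Euc n) 1) := by
  refine ⟨convex_closedBall _ _, by simp, isCompact_closedBall _ _, ?_⟩
  rw [mem_interior_iff_mem_nhds]
  exact Metric.closedBall_mem_nhds 0 one_pos

lemma ball_uncond (n : ℕ) : HasOneUncondBasis n (Metric.closedBall (0 : Euc n) 1) := by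
  refine ⟨(EuclideanSpace.basisFun (Fin n) ℝ).toBasis, fun lam => ?_⟩
  rw [gauge_closedBall zero_le_one, gauge_closedBall zero_le_one]
  congr 1
  have h : ∀ l : Fin n → ℝ, ‖∑ i, l i • (EuclideanSpace.basisFun (Fin n) ℝ).toBasis i‖ ^ 2 = ∑ i, l i ^ 2 := by
    intro l
    simp only [OrthonormalBasis.coe_toBasis]
    rw [← real_inner_self_eq_norm_sq, (EuclideanSpace.basisFun (Fin n) ℝ).orthonormal.inner_sum]
    simp [pow_two]
  rw [← sq_eq_sq₀ (norm_nonneg _) (norm_nonneg _), h, h]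
  simp

lemma distBM_nonneg {n : ℕ} (K L : Set (Euc n)) : 0 ≤ distBM n K L := by
  refine Real.sInf_nonneg ?_
  rintro _ ⟨T, rfl⟩
  exact mul_nonneg (opNorm_nonneg _ _ _) (opNorm_nonneg _ _ _)

lemma upper_ball {n m : ℕ} (hn : 1 ≤ n) (hm : 1 ≤ m) (x : Fin m → Euc n) (c : ℝ) (hc : 0 < c)
    (hx : ∀ z : Euc n, c * m * ‖z‖ ≤ Usum x z) :
    distBM n (absConv n (range x)) (Metric.closedBall (0 : Euc n) 1) ≤ Real.sqrt n := by
  obtain ⟨T, hT1, hT2⟩ := john hn hm x c hc hx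
  have hB := absConv_body hm x c hc hx
  have n1 : (1 : ℝ) ≤ n := by exact_mod_cast hn
  have sn : 0 < Real.sqrt n := Real.sqrt_pos.2 (by linarith)
  set B := absConv n (range x) with hBdef
  have hbdd : BddBelow {d : ℝ | ∃ T : Euc n ≃ₗ[ℝ] Euc n,
    d = bodyOpNorm n B (Metric.closedBall 0 1) T.toLinearMap * bodyOpNorm n (Metric.closedBall 0 1) B T.symm.toLinearMap} := by
    refine ⟨0, ?_⟩
    rintro _ ⟨T, rfl⟩
    exact mul_nonneg (opNorm_nonneg _ _ _) (opNorm_nonneg _ _ _)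
  refine (csInf_le hbdd ⟨T, rfl⟩).trans ?_
  have h1 : bodyOpNorm n B (Metric.closedBall 0 1) T.toLinearMap ≤ 1 := by
    refine csSup_le ⟨_, 0, interior_subset hB.2.2.2, rfl⟩ ?_
    rintro _ ⟨y, hy, rfl⟩
    have : B ⊆ T.toLinearMap ⁻¹' Metric.closedBall 0 1 := by
      refine convexHull_min ?_ ((convex_closedBall _ _).linear_preimage _)
      rintro y (⟨i, rfl⟩ | ⟨i, hi⟩)
      · simpa using hT1 i
      · have h1 := hT1 i
        rw [hi] at h1
        simpa using h1
    exact gauge_le_one_of_mem (this hy)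
  have h2 : bodyOpNorm n (Metric.closedBall 0 1) B T.symm.toLinearMap ≤ Real.sqrt n := by
    refine csSup_le ⟨_, 0, by simp, rfl⟩ ?_
    rintro _ ⟨z, hz, rfl⟩
    rw [mem_closedBall_zero_iff] at hz
    have h3 : (Real.sqrt n)⁻¹ • T.symm z ∈ B := by
      apply hT2
      rw [map_smul, T.apply_symm_apply, norm_smul, norm_inv, Real.norm_of_nonneg sn.le]
      field_simp
      exact hz
    have h4 : gauge B ((Real.sqrt n)⁻¹ • T.symm z) ≤ 1 := gauge_le_one_of_mem h3
    rw [gauge_smul_of_nonneg (by positivity), smul_eq_mul, inv_mul_le_iff₀ sn, mul_one] at h4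
    exact h4
  calc _ ≤ 1 * Real.sqrt n := mul_le_mul h1 h2 (opNorm_nonneg _ _ _) zero_le_one
    _ = _ := one_mul _


lemma statement_aux :
    ∃ C₀ c : ℝ, 1 ≤ C₀ ∧ 0 < c ∧
      ∀ (n : ℕ) (μ : Measure (Euc n)), IsIsotropicLogConcave n μ →
      ∀ (m : ℕ), C₀ * n ≤ m → (m : ℝ) ≤ 2 * C₀ * n →
      (1 / 2 : ℝ≥0∞) <
        (Measure.pi fun _ : Fin m => μ)
          {x : Fin m → Euc n |
            c * Real.sqrt n ≤
              sInf {d : ℝ | ∃ L : Set (Euc n), IsSymmConvexBody n L ∧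
                HasOneUncondBasis n L ∧ d = distBM n (absConv n (Set.range x)) L} ∧
            sInf {d : ℝ | ∃ L : Set (Euc n), IsSymmConvexBody n L ∧
                HasOneUncondBasis n L ∧ d = distBM n (absConv n (Set.range x)) L} ≤
              Real.sqrt n} := by
  obtain ⟨C₀, c, hC, hc, h⟩ := good_event
  refine ⟨C₀, c / ((8 : ℝ) ^ (2 * C₀) * (Real.exp 1 * Real.sqrt Real.pi)), hC, ?_, fun n μ hμ m hm1 hm2 => ?_⟩
  · have hpi : 0 < Real.sqrt Real.pi := Real.sqrt_pos.2 Real.pi_pos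
    positivity
  have hprob : IsProbabilityMeasure μ := by obtain ⟨f, _, _, _, hp, _⟩ := hμ; exact hp
  rcases Nat.eq_zero_or_pos n with rfl | hn
  · have hz : ∀ (K L : Set (Euc 0)) (T : Euc 0 →ₗ[ℝ] Euc 0), bodyOpNorm 0 K L T = 0 := by
      intro K L T
      refine le_antisymm (Real.sSup_nonpos ?_) (opNorm_nonneg _ _ _)
      rintro _ ⟨x, _, rfl⟩
      have : T x = 0 := Subsingleton.elim _ _
      simp [this]
    have hd : ∀ (K L : Set (Euc 0)), distBM 0 K L = 0 := by
      intro K L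
      refine le_antisymm (Real.sInf_nonpos ?_) (distBM_nonneg _ _)
      rintro _ ⟨T, rfl⟩
      simp [hz]
    have hs : ∀ x : Fin m → Euc 0, sInf {d : ℝ | ∃ L : Set (Euc 0), IsSymmConvexBody 0 L ∧
                HasOneUncondBasis 0 L ∧ d = distBM 0 (absConv 0 (Set.range x)) L} = 0 := by
      intro x
      refine le_antisymm (Real.sInf_nonpos ?_) (Real.sInf_nonneg ?_)
      · rintro _ ⟨L, _, _, rfl⟩
        exact (hd _ _).le
      · rintro _ ⟨L, _, _, rfl⟩
        exact (hd _ _).ge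
    simp only [hs]
    simp only [Nat.cast_zero, Real.sqrt_zero, mul_zero, le_refl, and_self, setOf_true, measure_univ]
    rw [ENNReal.div_lt_iff (by simp) (by simp)]
    norm_num
  have n1 : (1 : ℝ) ≤ n := by exact_mod_cast hn
  have hm : 1 ≤ m := by
    have : (1:ℝ) ≤ m := by nlinarith
    exact_mod_cast this
  refine h n hn μ hμ m hm1 _ fun x hx htr => ?_
  have hne : ({d : ℝ | ∃ L : Set (Euc n), IsSymmConvexBody n L ∧
                HasOneUncondBasis n L ∧ d = distBM n (absConv n (Set.range x)) L}).Nonempty :=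
    ⟨_, Metric.closedBall 0 1, ball_body n, ball_uncond n, rfl⟩
  refine ⟨le_csInf hne ?_, ?_⟩
  · rintro _ ⟨L, hL, hU, rfl⟩
    refine le_csInf ⟨_, LinearEquiv.refl ℝ _, rfl⟩ ?_
    rintro _ ⟨T, rfl⟩
    exact lower_one hn hm x c hc hx htr C₀ hm2 L hL hU T
  · refine le_trans (csInf_le ?_ ?_) (upper_ball hn hm x c hc hx)
    · refine ⟨0, ?_⟩
      rintro _ ⟨L, _, _, rfl⟩
      exact distBM_nonneg _ _
    · exact ⟨Metric.closedBall 0 1, ball_body n, ball_uncond n, rfl⟩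


theorem statement_19 :
    ∃ C₀ c : ℝ, 1 ≤ C₀ ∧ 0 < c ∧
      ∀ (n : ℕ) (μ : Measure (Euc n)), IsIsotropicLogConcave n μ →
      ∀ (m : ℕ), C₀ * n ≤ m → (m : ℝ) ≤ 2 * C₀ * n →
      (1 / 2 : ℝ≥0∞) <
        (Measure.pi fun _ : Fin m => μ)
          {x : Fin m → Euc n |
            c * Real.sqrt n ≤
              sInf {d : ℝ | ∃ L : Set (Euc n), IsSymmConvexBody n L ∧
                HasOneUncondBasis n L ∧ d = distBM n (absConv n (Set.range x)) L} ∧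
            sInf {d : ℝ | ∃ L : Set (Euc n), IsSymmConvexBody n L ∧
                HasOneUncondBasis n L ∧ d = distBM n (absConv n (Set.range x)) L} ≤
              Real.sqrt n} := by
  exact statement_aux

end
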